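/- arXiv:math/0306119 — 3 statements merged into one kernel-verified Lean document; each statement's English description precedes it below -/
import Mathlib

section
/- Fix 1 ≤ k ≤ r. There exists n₀ such that for all n ≥ n₀, β(n,r,k) = |{C ∈ [n]^(k) : C ∩ [α^(r−k+1)] ≠ ∅}| = C(n,k) − C(n − α^(r−k+1), k), where C(·,·) denotes the binomial coefficient. -/
open Finset

/-- The ground set `[n] = {1, …, n}`. -/
def grd (n : ℕ) : Finset ℕ := Finset.Icc 1 n

/-- `[n]^(k)`: all `k`-element subsets of `[n]`. -/
def ksets (n k : ℕ) : Finset (Finset ℕ) := (grd n).powersetCard k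

/-- A family of sets is intersecting if any two of its members meet. -/
def IsIntersecting (𝒜 : Finset (Finset ℕ)) : Prop :=
  ∀ A ∈ 𝒜, ∀ B ∈ 𝒜, (A ∩ B).Nonempty

/-- `𝒜⟨k⟩`: the collection of `k`-sets arising as pairwise intersections of members of `𝒜`. -/
def interk (𝒜 : Finset (Finset ℕ)) (k : ℕ) : Finset (Finset ℕ) :=
  ((𝒜 ×ˢ 𝒜).image fun p => p.1 ∩ p.2).filter fun C => C.card = k

/-- `𝒜⟨1⟩` identified with a set of points: all `x` with `{x} = A ∩ B` for some `A, B ∈ 𝒜`. -/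
def interPts (𝒜 : Finset (Finset ℕ)) : Finset ℕ :=
  (interk 𝒜 1).sup id

/-- `β(n,r,k)`: the maximum of `|𝒜⟨k⟩|` over intersecting families `𝒜 ⊆ [n]^(r)`. -/
noncomputable def beta (n r k : ℕ) : ℕ :=
  sSup {m | ∃ 𝒜 ⊆ ksets n r, IsIntersecting 𝒜 ∧ (interk 𝒜 k).card = m}

/-- `α^(r) = max {β(n,r,1) : n ≥ r}` (finite by Lovász's theorem). -/
noncomputable def alpha (r : ℕ) : ℕ :=
  sSup {m | ∃ n, r ≤ n ∧ beta n r 1 = m}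

/-- `x` is a singleton intersection of the family. -/
def Sing (S : Finset (Finset ℕ)) (x : ℕ) : Prop := ∃ A ∈ S, ∃ B ∈ S, A ∩ B = {x}

lemma mem_interk {F : Finset (Finset ℕ)} {k : ℕ} {C : Finset ℕ} :
    C ∈ interk F k ↔ (∃ A ∈ F, ∃ B ∈ F, A ∩ B = C) ∧ C.card = k := by
  simp only [interk, mem_filter, mem_image, mem_product, Prod.exists]
  constructor
  · rintro ⟨⟨A, B, ⟨h1, h2⟩, h3⟩, h4⟩
    exact ⟨⟨A, h1, B, h2, h3⟩, h4⟩
  · rintro ⟨⟨A, h1, B, h2, h3⟩, h4⟩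
    exact ⟨⟨A, B, ⟨h1, h2⟩, h3⟩, h4⟩

lemma mem_ksets {n k : ℕ} {C : Finset ℕ} : C ∈ ksets n k ↔ C ⊆ grd n ∧ C.card = k := by
  simp [ksets, mem_powersetCard]

lemma card_grd (n : ℕ) : (grd n).card = n := by simp [grd]

lemma interk_subset {n r k : ℕ} {F : Finset (Finset ℕ)} (hF : F ⊆ ksets n r) :
    interk F k ⊆ ksets n k := by
  intro C hC
  obtain ⟨⟨A, hA, B, hB, h⟩, hk⟩ := mem_interk.1 hC
  refine mem_ksets.2 ⟨?_, hk⟩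
  rw [← h]
  exact inter_subset_left.trans (mem_ksets.1 (hF hA)).1

lemma beta_bdd (n r k : ℕ) :
    BddAbove {m | ∃ F ⊆ ksets n r, IsIntersecting F ∧ (interk F k).card = m} := by
  refine ⟨(ksets n k).card, ?_⟩
  rintro m ⟨F, hF, -, rfl⟩
  exact card_le_card (interk_subset hF)

lemma beta_nonempty (n r k : ℕ) :
    {m | ∃ F ⊆ ksets n r, IsIntersecting F ∧ (interk F k).card = m}.Nonempty :=
  ⟨_, ∅, by simp, by simp [IsIntersecting], rfl⟩

lemma le_beta {n r k : ℕ} {F : Finset (Finset ℕ)} (hF : F ⊆ ksets n r) (hI : IsIntersecting F) :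
    (interk F k).card ≤ beta n r k :=
  le_csSup (beta_bdd n r k) ⟨F, hF, hI, rfl⟩

lemma beta_mem (n r k : ℕ) :
    ∃ F ⊆ ksets n r, IsIntersecting F ∧ (interk F k).card = beta n r k :=
  Nat.sSup_mem (beta_nonempty n r k) (beta_bdd n r k)

/-- Branching: few transversals suffice. -/
lemma branch (r : ℕ) (hr : 1 ≤ r) (F : Finset (Finset ℕ)) (hF : ∀ A ∈ F, A.card ≤ r) (j : ℕ) :
    ∀ T : Finset ℕ, ∃ L : Finset (Finset ℕ), L.card ≤ r ^ j ∧
      (∀ B ∈ L, ∀ A ∈ F, (B ∩ A).Nonempty) ∧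
      ∀ A : Finset ℕ, (∀ A' ∈ F, (A ∩ A').Nonempty) → T ⊆ A → A.card ≤ T.card + j →
        ∃ B ∈ L, B ⊆ A := by
  induction j with
  | zero =>
    intro T
    by_cases hT : ∀ A ∈ F, (T ∩ A).Nonempty
    · exact ⟨{T}, by simp, by simpa using hT, fun A _ h _ => ⟨T, by simp, h⟩⟩
    · refine ⟨∅, by simp, by simp, fun A hA h hc => ?_⟩
      exfalso
      have := eq_of_subset_of_card_le h (by simpa using hc)
      exact hT (this ▸ hA)
  | succ j ih =>
    intro T
    by_cases hT : ∀ A ∈ F, (T ∩ A).Nonempty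
    · exact ⟨{T}, by simpa using Nat.one_le_pow _ _ hr, by simpa using hT,
        fun A _ h _ => ⟨T, by simp, h⟩⟩
    · push Not at hT
      obtain ⟨G, hG, hTG⟩ := hT
      choose L h1 h2 h3 using ih
      refine ⟨G.biUnion fun x => L (insert x T), ?_, ?_, ?_⟩
      · calc _ ≤ G.card * r ^ j := card_biUnion_le_card_mul _ _ _ fun x _ => h1 _
          _ ≤ r * r ^ j := Nat.mul_le_mul_right _ (hF G hG)
          _ = r ^ (j + 1) := by ring
      · intro B hB
        obtain ⟨x, hx, hB⟩ := mem_biUnion.1 hB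
        exact h2 _ B hB
      · intro A hA hTA hc
        obtain ⟨x, hx⟩ := hA G hG
        rw [mem_inter] at hx
        have hxT : x ∉ T := fun h => by
          have : x ∈ T ∩ G := mem_inter.2 ⟨h, hx.2⟩
          simp [hTG] at this
        obtain ⟨B, hB, hBA⟩ := h3 (insert x T) A hA (insert_subset hx.1 hTA)
          (by rw [card_insert_of_notMem hxT]; omega)
        exact ⟨B, mem_biUnion.2 ⟨x, hx.2, hB⟩, hBA⟩

lemma kernel (r : ℕ) (hr : 1 ≤ r) : ∃ K : ℕ, ∀ n, 2 * r ≤ n → ∀ F ⊆ ksets n r, IsIntersecting F →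
    ∃ G : Finset (Finset ℕ), IsIntersecting G ∧ (G.sup id).card ≤ K ∧ (∀ B ∈ G, B ⊆ grd n) ∧
      ∀ A ∈ F, ∃ B ∈ G, B ⊆ A := by
  refine ⟨r ^ r * r, fun n hn F0 hF0 hI0 => ?_⟩
  obtain ⟨F, hle, hmax⟩ := Finite.exists_le_maximal
    (α := {F : Finset (Finset ℕ) // F ∈ (ksets n r).powerset})
    (p := fun F => IsIntersecting F.1) (a := ⟨F0, mem_powerset.2 hF0⟩) hI0
  obtain ⟨F, hF⟩ := F
  have hI : IsIntersecting F := hmax.prop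
  have hF' := mem_powerset.1 hF
  have hle' : F0 ⊆ F := hle
  have key : ∀ A ∈ ksets n r, (∀ B ∈ F, (A ∩ B).Nonempty) → A ∈ F := by
    intro A hA h
    have hne : A.Nonempty := by
      rw [← card_pos, (mem_ksets.1 hA).2]; exact hr
    have h2 : IsIntersecting (insert A F) := by
      intro X hX Y hY
      rw [mem_insert] at hX hY
      rcases hX with rfl | hX <;> rcases hY with rfl | hY
      · simpa using hne
      · exact h _ hY
      · rw [inter_comm]; exact h _ hX
      · exact hI _ hX _ hY
    have := hmax.le_of_ge (y := ⟨insert A F, mem_powerset.2 (insert_subset hA hF')⟩) h2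
      (subset_insert A F)
    exact this (mem_insert_self A F)
  obtain ⟨L, hL1, hL2, hL3⟩ := branch r hr F (fun A hA => (mem_ksets.1 (hF' hA)).2.le) r ∅
  classical
  refine ⟨L.filter fun B => ∃ A ∈ F, B ⊆ A, ?_, ?_, ?_, ?_⟩
  · intro B hB B' hB'
    rw [mem_filter] at hB hB'
    obtain ⟨hB, A, hA, hBA⟩ := hB
    obtain ⟨hB', A', hA', hBA'⟩ := hB'
    by_contra hcon
    rw [not_nonempty_iff_eq_empty, ← disjoint_iff_inter_eq_empty] at hcon
    obtain ⟨hAn, hAc⟩ := mem_ksets.1 (hF' hA)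
    obtain ⟨hAn', hAc'⟩ := mem_ksets.1 (hF' hA')
    have hb := card_le_card hBA
    have hb' := card_le_card hBA'
    have hs : B ⊆ grd n \ B' := subset_sdiff.2 ⟨hBA.trans hAn, hcon⟩
    have hc : r ≤ (grd n \ B').card := by
      rw [card_sdiff_of_subset (hBA'.trans hAn'), card_grd]; omega
    obtain ⟨D, hD1, hD2, hD3⟩ := exists_subsuperset_card_eq hs (by omega) hc
    have hDF : D ∈ F := by
      apply key
      · exact mem_ksets.2 ⟨hD2.trans sdiff_subset, hD3⟩
      · intro X hX
        exact (hL2 B hB X hX).mono (inter_subset_inter_right hD1)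
    obtain ⟨x, hx⟩ := hL2 B' hB' D hDF
    rw [mem_inter] at hx
    exact (mem_sdiff.1 (hD2 hx.2)).2 hx.1
  · rw [sup_eq_biUnion]
    refine (card_biUnion_le_card_mul _ _ r ?_).trans
      (Nat.mul_le_mul_right _ ((card_filter_le _ _).trans hL1))
    intro B hB
    obtain ⟨hB, A, hA, hBA⟩ := mem_filter.1 hB
    exact (card_le_card hBA).trans (mem_ksets.1 (hF' hA)).2.le
  · intro B hB
    obtain ⟨hB, A, hA, hBA⟩ := mem_filter.1 hB
    exact hBA.trans (mem_ksets.1 (hF' hA)).1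
  · intro A hA
    obtain ⟨B, hB, hBA⟩ := hL3 A (fun A' hA' => hI A (hle' hA) A' hA') (by simp)
      (by simpa using (mem_ksets.1 (hF' (hle' hA))).2.le)
    exact ⟨B, mem_filter.2 ⟨hB, A, hle' hA, hBA⟩, hBA⟩

/-- Finiteness (Lovász). -/
lemma alpha_bdd (s : ℕ) (hs : 1 ≤ s) : BddAbove {m | ∃ n, s ≤ n ∧ beta n s 1 = m} := by
  obtain ⟨K, hK⟩ := kernel s hs
  refine ⟨K, ?_⟩
  rintro m ⟨n, hn, rfl⟩
  obtain ⟨F, hF, hI, hc⟩ := beta_mem n s 1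
  rw [← hc]
  have hF2 : F ⊆ ksets (2 * s + n) s := by
    intro A hA
    have := mem_ksets.1 (hF hA)
    refine mem_ksets.2 ⟨this.1.trans ?_, this.2⟩
    exact Icc_subset_Icc_right (by omega)
  obtain ⟨G, hG, hGK, -, hG3⟩ := hK (2 * s + n) (by omega) F hF2 hI
  refine le_trans ?_ hGK
  refine (card_le_card (t := (G.sup id).image fun x => {x}) ?_).trans card_image_le
  intro C hC
  obtain ⟨⟨A, hA, A', hA', h⟩, hk⟩ := mem_interk.1 hC
  obtain ⟨x, rfl⟩ := card_eq_one.1 hk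
  obtain ⟨B, hB, hBA⟩ := hG3 A hA
  obtain ⟨B', hB', hBA'⟩ := hG3 A' hA'
  obtain ⟨y, hy⟩ := hG B hB B' hB'
  have : y ∈ ({x} : Finset ℕ) := h ▸ inter_subset_inter hBA hBA' hy
  rw [mem_singleton] at this
  subst this
  refine mem_image.2 ⟨y, ?_, rfl⟩
  exact (le_sup (f := id) hB : B ⊆ G.sup id) (mem_inter.1 hy).1

lemma alpha_mem (s : ℕ) (hs : 1 ≤ s) : ∃ n, s ≤ n ∧ beta n s 1 = alpha s :=
  Nat.sSup_mem (s := {m | ∃ n, s ≤ n ∧ beta n s 1 = m}) ⟨_, s, le_rfl, rfl⟩ (alpha_bdd s hs)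

lemma le_alpha (s : ℕ) (hs : 1 ≤ s) (S : Finset (Finset ℕ)) (hI : IsIntersecting S)
    (hc : ∀ A ∈ S, A.card ≤ s) (X : Finset ℕ) (hX : ∀ x ∈ X, Sing S x) : X.card ≤ alpha s := by
  let e : ℕ ⊕ (Finset ℕ × Bool × ℕ) ↪ ℕ :=
    ⟨fun a => Encodable.encode a + 1, fun a b h => Encodable.encode_injective (by simpa using h)⟩
  let q : Finset ℕ × Bool → Finset (ℕ ⊕ (Finset ℕ × Bool × ℕ)) := fun p =>
    p.1.disjSum ((range (s - p.1.card)).image fun j => (p.1, p.2, j))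
  have hq : ∀ p, p.1.card ≤ s → (q p).card = s := by
    intro p hp
    simp only [q]
    rw [card_disjSum, card_image_of_injective _ (fun a b h => by simpa using h), card_range]
    omega
  let T : Finset (Finset ℕ) := (S ×ˢ (univ : Finset Bool)).image fun p => (q p).map e
  have hTm : ∀ A ∈ S, ∀ b, (q (A, b)).map e ∈ T := fun A hA b =>
    mem_image.2 ⟨(A, b), by simp [hA], rfl⟩
  have hinl : ∀ x A b, e (Sum.inl x) ∈ (q (A, b)).map e ↔ x ∈ A := by
    intro x A b
    simp [q]
  have hTI : IsIntersecting T := by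
    intro A hA B hB
    obtain ⟨⟨A, b⟩, hA1, rfl⟩ := mem_image.1 hA
    obtain ⟨⟨B, c⟩, hB1, rfl⟩ := mem_image.1 hB
    obtain ⟨x, hx⟩ := hI A (mem_product.1 hA1).1 B (mem_product.1 hB1).1
    rw [mem_inter] at hx
    exact ⟨e (Sum.inl x), mem_inter.2 ⟨(hinl _ _ _).2 hx.1, (hinl _ _ _).2 hx.2⟩⟩
  set n := s + (T.sup id).sup id with hn
  have hT : T ⊆ ksets n s := by
    intro A hA
    refine mem_ksets.2 ⟨?_, ?_⟩
    · intro x hx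
      have h1 : x ∈ T.sup id := (le_sup (f := id) hA : A ⊆ T.sup id) hx
      have h2 : x ≤ (T.sup id).sup id := le_sup (f := id) h1
      obtain ⟨⟨A, b⟩, hA, rfl⟩ := mem_image.1 hA
      obtain ⟨u, hu, rfl⟩ := mem_map.1 hx
      refine mem_Icc.2 ⟨?_, by omega⟩
      exact Nat.le_add_left 1 _
    · obtain ⟨⟨A, b⟩, hA1, rfl⟩ := mem_image.1 hA
      rw [card_map]
      exact hq _ (hc _ (mem_product.1 hA1).1)
  have h1 : X.card ≤ (interk T 1).card := by
    refine card_le_card_of_injOn (fun x => {e (Sum.inl x)}) ?_ ?_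
    · intro x hx
      obtain ⟨A, hA, B, hB, h⟩ := hX x hx
      refine mem_interk.2 ⟨⟨_, hTm A hA false, _, hTm B hB true, ?_⟩, by simp⟩
      show _ = {e (Sum.inl x)}
      rw [← map_inter, ← map_singleton]
      congr 1
      ext u
      rcases u with u | ⟨u, b, j⟩
      · have : u ∈ A ∩ B ↔ u = x := by rw [h]; simp
        rw [mem_inter] at this
        simp [q, this]
      · simp [q]
        intros
        subst_vars
        simp_all
    · intro x _ y _ h
      simpa using h
  have h2 : (interk T 1).card ≤ beta n s 1 := le_beta hT hTI
  have h3 : beta n s 1 ≤ alpha s := le_csSup (alpha_bdd s hs) ⟨n, by omega, rfl⟩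
  omega

lemma alpha_pos (s : ℕ) (hs : 1 ≤ s) : 1 ≤ alpha s := by
  have := le_alpha s hs {{1}} (by simp [IsIntersecting]) (by simpa using hs) {1}
    (by simp [Sing])
  simpa using this

lemma opt_trim (s : ℕ) (hs : 1 ≤ s) (S : Finset (Finset ℕ)) (hI : IsIntersecting S)
    (hc : ∀ A ∈ S, A.card ≤ s) (X : Finset ℕ) (hX : ∀ x ∈ X, Sing S x) (hXc : X.card = alpha s)
    (C : Finset ℕ) : Disjoint C X → IsIntersecting (S.image (· \ C)) ∧
      (∀ A ∈ S.image (· \ C), A.card ≤ s) ∧ ∀ x ∈ X, Sing (S.image (· \ C)) x := by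
  intro hd
  refine ⟨?_, ?_, ?_⟩
  · induction C using Finset.induction_on with
    | empty => simpa using hI
    | insert c C hcC ih =>
      rw [disjoint_insert_left] at hd
      have hIC := ih hd.2
      intro A0 hA0 B0 hB0
      obtain ⟨A, hA, rfl⟩ := mem_image.1 hA0
      obtain ⟨B, hB, rfl⟩ := mem_image.1 hB0
      by_contra hcon
      obtain ⟨y, hy⟩ := hIC _ (mem_image_of_mem _ hA) _ (mem_image_of_mem _ hB)
      have hall : ∀ y ∈ (A \ C) ∩ (B \ C), y = c := by
        intro y hy
        by_contra hne
        apply hcon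
        refine ⟨y, ?_⟩
        simp only [mem_inter, mem_sdiff, mem_insert] at hy ⊢
        tauto
      have hsing : (A \ C) ∩ (B \ C) = {c} := by
        ext u
        rw [mem_singleton]
        exact ⟨hall u, fun h => by rw [h, ← hall y hy]; exact hy⟩
      have := le_alpha s hs (S.image (· \ C)) hIC (by
        intro A0 hA0
        obtain ⟨A, hA, rfl⟩ := mem_image.1 hA0
        exact (card_le_card sdiff_subset).trans (hc A hA)) (insert c X) (by
        intro x hx
        rw [mem_insert] at hx
        rcases hx with rfl | hx
        · exact ⟨_, mem_image_of_mem _ hA, _, mem_image_of_mem _ hB, hsing⟩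
        · obtain ⟨A', hA', B', hB', h⟩ := hX x hx
          refine ⟨_, mem_image_of_mem _ hA', _, mem_image_of_mem _ hB', ?_⟩
          have hxC : x ∉ C := fun h => disjoint_left.1 hd.2 h hx
          ext u
          have : u ∈ A' ∩ B' ↔ u = x := by rw [h]; simp
          simp only [mem_inter, mem_sdiff, mem_singleton] at this ⊢
          constructor
          · tauto
          · rintro rfl; tauto)
      rw [card_insert_of_notMem hd.1] at this
      omega
  · intro A0 hA0
    obtain ⟨A, hA, rfl⟩ := mem_image.1 hA0
    exact (card_le_card sdiff_subset).trans (hc A hA)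
  · intro x hx
    obtain ⟨A', hA', B', hB', h⟩ := hX x hx
    refine ⟨_, mem_image_of_mem _ hA', _, mem_image_of_mem _ hB', ?_⟩
    have hxC : x ∉ C := fun h => disjoint_left.1 hd h hx
    ext u
    have : u ∈ A' ∩ B' ↔ u = x := by rw [h]; simp
    simp only [mem_inter, mem_sdiff, mem_singleton] at this ⊢
    constructor
    · tauto
    · rintro rfl; tauto

lemma exists_fresh (S : Finset (Finset ℕ)) (X : Finset ℕ) : ∃ y, y ∉ X ∧ ∀ A ∈ S, y ∉ A := by
  obtain ⟨y, hy⟩ := Infinite.exists_notMem_finset (X ∪ S.sup id)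
  rw [mem_union, not_or] at hy
  exact ⟨y, hy.1, fun A hA h => hy.2 ((le_sup (f := id) hA : A ⊆ S.sup id) h)⟩

lemma opt_cover (s : ℕ) (hs : 1 ≤ s) (S : Finset (Finset ℕ)) (hI : IsIntersecting S)
    (hc : ∀ A ∈ S, A.card ≤ s) (X : Finset ℕ) (hX : ∀ x ∈ X, Sing S x) (hXc : X.card = alpha s)
    (a : Finset ℕ) (ha : a.card + 1 ≤ s)
    (hfull : ∀ A ∈ S, A.card = s → (A ∩ a).Nonempty) : ∀ A ∈ S, (A ∩ a).Nonempty := by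
  intro T0 hT0
  by_contra hcon
  rcases a.eq_empty_or_nonempty with rfl | ⟨z, hz⟩
  ·
    have hs' : ∀ A ∈ S, A.card + 1 ≤ s := by
      intro A hA
      have := hc A hA
      rcases this.eq_or_lt with h | h
      · simpa using hfull A hA h
      · exact h
    obtain ⟨w, hwX, hw⟩ := exists_fresh S X
    have hs2 : 2 ≤ s := by
      have h1 := hs' T0 hT0
      have h2 := card_pos.2 (by simpa using hI T0 hT0 T0 hT0 : T0.Nonempty)
      omega
    obtain ⟨y, hyX, hy⟩ := exists_fresh S (insert w X)
    rw [mem_insert, not_or] at hyX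
    have := le_alpha s hs (S.image (insert y) ∪ S.image (insert w) ∪ {{w, y}}) (by
      intro A hA B hB
      simp only [mem_union, mem_image, mem_singleton] at hA hB
      rcases hA with (⟨A, hA, rfl⟩ | ⟨A, hA, rfl⟩) | rfl <;>
      rcases hB with (⟨B, hB, rfl⟩ | ⟨B, hB, rfl⟩) | rfl
      · exact ⟨y, by simp⟩
      · exact (hI A hA B hB).mono (inter_subset_inter (subset_insert _ _) (subset_insert _ _))
      · exact ⟨y, by simp⟩
      · exact (hI A hA B hB).mono (inter_subset_inter (subset_insert _ _) (subset_insert _ _))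
      · exact ⟨w, by simp⟩
      · exact ⟨w, by simp⟩
      · exact ⟨y, by simp⟩
      · exact ⟨w, by simp⟩
      · exact ⟨w, by simp⟩) (by
      intro A hA
      simp only [mem_union, mem_image, mem_singleton] at hA
      rcases hA with (⟨A, hA, rfl⟩ | ⟨A, hA, rfl⟩) | rfl
      · exact (card_insert_le _ _).trans (hs' A hA)
      · exact (card_insert_le _ _).trans (hs' A hA)
      · exact card_le_two.trans hs2) (insert y X) (by
      intro x hx
      rw [mem_insert] at hx
      rcases hx with rfl | hx
      · refine ⟨insert x T0, mem_union_left _ (mem_union_left _ (mem_image_of_mem _ hT0)), {w, x}, by simp, ?_⟩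
        ext u
        simp only [mem_inter, mem_insert, mem_singleton]
        constructor
        · rintro ⟨h1 | h1, rfl | h2⟩
          · exact h1
          · exact h1
          · exact absurd h1 (hw _ hT0)
          · exact h2
        · tauto
      · obtain ⟨A, hA, B, hB, h⟩ := hX x hx
        refine ⟨insert y A, mem_union_left _ (mem_union_left _ (mem_image_of_mem _ hA)), insert w B,
          mem_union_left _ (mem_union_right _ (mem_image_of_mem _ hB)), ?_⟩
        ext u
        have hu : u ∈ A ∩ B ↔ u = x := by rw [h]; simp
        rw [mem_inter] at hu
        simp only [mem_inter, mem_insert, mem_singleton]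
        constructor
        · rintro ⟨rfl | h1, rfl | h2⟩
          · exact absurd rfl hyX.1
          · exact absurd h2 (hy B hB)
          · exact absurd h1 (hw A hA)
          · exact hu.1 ⟨h1, h2⟩
        · tauto)
    rw [card_insert_of_notMem hyX.2] at this
    omega
  · obtain ⟨y, hyX, hy⟩ := exists_fresh S (a ∪ X)
    rw [mem_union, not_or] at hyX
    classical
    let M := S.filter fun A => ¬ (A ∩ a).Nonempty
    have hM : ∀ A ∈ M, A ∈ S ∧ ¬ (A ∩ a).Nonempty := fun A hA => mem_filter.1 hA
    let H := S.filter fun A => (A ∩ a).Nonempty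
    have hH : ∀ A ∈ H, A ∈ S ∧ (A ∩ a).Nonempty := fun A hA => mem_filter.1 hA
    have hMs : ∀ A ∈ M, A.card + 1 ≤ s := by
      intro A hA
      obtain ⟨hA, hA'⟩ := hM A hA
      rcases (hc A hA).eq_or_lt with h | h
      · exact absurd (hfull A hA h) hA'
      · exact h
    have hMd : ∀ A ∈ M, ∀ u ∈ A, u ∉ a := fun A hA u hu hua =>
      (hM A hA).2 ⟨u, mem_inter.2 ⟨hu, hua⟩⟩
    have hT0M : T0 ∈ M := mem_filter.2 ⟨hT0, hcon⟩
    let N := H ∪ M.image (insert y) ∪ M.image (insert z)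
    have hN : ∀ A ∈ N, (∃ B ∈ S, B ⊆ A) ∧ (insert y a ∩ A).Nonempty ∧ A.card ≤ s := by
      intro A hA
      simp only [N, mem_union, mem_image] at hA
      rcases hA with (hA | ⟨A, hA, rfl⟩) | ⟨A, hA, rfl⟩
      · refine ⟨⟨A, (hH A hA).1, subset_rfl⟩, ?_, hc A (hH A hA).1⟩
        rw [inter_comm]
        exact (hH A hA).2.mono (inter_subset_inter_left (subset_insert _ _))
      · exact ⟨⟨A, (hM A hA).1, subset_insert _ _⟩, ⟨y, by simp⟩,
          (card_insert_le _ _).trans (hMs A hA)⟩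
      · exact ⟨⟨A, (hM A hA).1, subset_insert _ _⟩, ⟨z, by simp [hz]⟩,
          (card_insert_le _ _).trans (hMs A hA)⟩
    have hH' : ∀ A ∈ H, A ∈ insert (insert y a) N := fun A hA => by
      simp only [N, mem_union, mem_insert]; tauto
    have hMy : ∀ A ∈ M, insert y A ∈ insert (insert y a) N := fun A hA => by
      simp only [N, mem_union, mem_insert, mem_image]
      exact Or.inr (Or.inl (Or.inr ⟨A, hA, rfl⟩))
    have hMz : ∀ A ∈ M, insert z A ∈ insert (insert y a) N := fun A hA => by
      simp only [N, mem_union, mem_insert, mem_image]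
      exact Or.inr (Or.inr ⟨A, hA, rfl⟩)
    have := le_alpha s hs (insert (insert y a) N) (by
      intro A hA B hB
      rw [mem_insert] at hA hB
      rcases hA with rfl | hA <;> rcases hB with rfl | hB
      · exact ⟨y, by simp⟩
      · exact (hN B hB).2.1
      · rw [inter_comm]; exact (hN A hA).2.1
      · obtain ⟨A', hA', h1⟩ := (hN A hA).1
        obtain ⟨B', hB', h2⟩ := (hN B hB).1
        exact (hI A' hA' B' hB').mono (inter_subset_inter h1 h2)) (by
      intro A hA
      rw [mem_insert] at hA
      rcases hA with rfl | hA
      · exact (card_insert_le _ _).trans ha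
      · exact (hN A hA).2.2) (insert y X) (by
      intro x hx
      rw [mem_insert] at hx
      rcases hx with rfl | hx
      · refine ⟨_, hMy T0 hT0M, insert x a, by simp, ?_⟩
        ext u
        have := hMd T0 hT0M u
        simp only [mem_inter, mem_insert, mem_singleton]
        tauto
      · obtain ⟨A, hA, B, hB, h⟩ := hX x hx
        have hu : ∀ u, u ∈ A ∧ u ∈ B ↔ u = x := by
          intro u
          rw [← mem_inter, h, mem_singleton]
        have hyA := hy A hA
        have hyB := hy B hB
        by_cases hAH : (A ∩ a).Nonempty
        · have hAH' : A ∈ H := mem_filter.2 ⟨hA, hAH⟩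
          by_cases hBH : (B ∩ a).Nonempty
          · exact ⟨A, hH' A hAH', B, hH' B (mem_filter.2 ⟨hB, hBH⟩), h⟩
          · refine ⟨A, hH' A hAH', _, hMy B (mem_filter.2 ⟨hB, hBH⟩), ?_⟩
            rw [inter_insert_of_notMem hyA, h]
        · have hAM : A ∈ M := mem_filter.2 ⟨hA, hAH⟩
          by_cases hBH : (B ∩ a).Nonempty
          · refine ⟨_, hMy A hAM, B, hH' B (mem_filter.2 ⟨hB, hBH⟩), ?_⟩
            rw [insert_inter_of_notMem hyB, h]
          · refine ⟨_, hMy A hAM, _, hMz B (mem_filter.2 ⟨hB, hBH⟩), ?_⟩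
            have hzA : z ∉ A := fun h => hMd A hAM z h hz
            have hyz : y ∉ insert z B := by
              rw [mem_insert, not_or]
              exact ⟨fun h => hyX.1 (h ▸ hz), hyB⟩
            rw [insert_inter_of_notMem hyz, inter_insert_of_notMem hzA, h])
    rw [card_insert_of_notMem hyX.2] at this
    omega

lemma card_meet (n k : ℕ) (P : Finset ℕ) (hP : P ⊆ grd n) :
    ((ksets n k).filter fun C => (C ∩ P).Nonempty).card = n.choose k - (n - P.card).choose k := by
  have h1 : ((ksets n k).filter fun C => ¬ (C ∩ P).Nonempty) = (grd n \ P).powersetCard k := by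
    ext C
    rw [mem_filter, mem_ksets, mem_powersetCard, subset_sdiff, not_nonempty_iff_eq_empty,
      ← disjoint_iff_inter_eq_empty]
    tauto
  have h2 := card_filter_add_card_filter_not (s := ksets n k) (fun C => (C ∩ P).Nonempty)
  rw [h1, card_powersetCard, card_sdiff_of_subset hP, card_grd] at h2
  have h3 : (ksets n k).card = n.choose k := by simp [ksets, card_grd]
  omega

lemma lower (k r : ℕ) (hk : 1 ≤ k) (hkr : k ≤ r) : ∃ n₀ : ℕ, ∀ n, n₀ ≤ n →
    n.choose k - (n - alpha (r - k + 1)).choose k ≤ beta n r k := by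
  obtain ⟨s, hs⟩ : ∃ s, s = r - k + 1 := ⟨_, rfl⟩
  rw [← hs]
  obtain ⟨m, hm, hma⟩ := alpha_mem s (by omega)
  obtain ⟨G, hG, hGI, hGc⟩ := beta_mem m s 1
  classical
  refine ⟨m + 2 * r, fun n hn => ?_⟩
  let P := (grd m).filter fun x => Sing G x
  have hmn : grd m ⊆ grd n := Icc_subset_Icc_right (by omega)
  have hPc : P.card = alpha s := by
    rw [← hma, ← hGc]
    have : interk G 1 = P.image fun x => {x} := by
      ext C
      rw [mem_interk, mem_image]
      constructor
      · rintro ⟨⟨A, hA, B, hB, h⟩, hc⟩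
        obtain ⟨x, rfl⟩ := card_eq_one.1 hc
        refine ⟨x, mem_filter.2 ⟨?_, A, hA, B, hB, h⟩, rfl⟩
        have : x ∈ A ∩ B := by rw [h]; simp
        exact (mem_ksets.1 (hG hA)).1 (mem_inter.1 this).1
      · rintro ⟨x, hx, rfl⟩
        exact ⟨(mem_filter.1 hx).2, by simp⟩
    rw [this, card_image_of_injective _ (fun a b h => by simpa using h)]
  rw [← hPc, ← card_meet n k P ((filter_subset _ _).trans hmn)]
  let F := (ksets n r).filter fun A => ∃ B ∈ G, B ⊆ A
  have hFI : IsIntersecting F := by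
    intro A hA A' hA'
    obtain ⟨-, B, hB, h⟩ := mem_filter.1 hA
    obtain ⟨-, B', hB', h'⟩ := mem_filter.1 hA'
    exact (hGI B hB B' hB').mono (inter_subset_inter h h')
  refine le_trans (card_le_card ?_) (le_beta (filter_subset _ _ : F ⊆ ksets n r) hFI)
  intro C hC
  rw [mem_filter, mem_ksets] at hC
  obtain ⟨⟨hCn, hCk⟩, x, hx⟩ := hC
  rw [mem_inter] at hx
  obtain ⟨hxC, hxP⟩ := hx
  obtain ⟨-, B, hB, B', hB', h⟩ := mem_filter.1 hxP
  have hxx : x ∈ B ∩ B' := by rw [h]; simp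
  rw [mem_inter] at hxx
  have hE : ∀ D ∈ G, x ∈ D → D ∪ C ⊆ grd n ∧ (D ∪ C).card ≤ r := by
    intro D hD hxD
    obtain ⟨h1, h2⟩ := mem_ksets.1 (hG hD)
    refine ⟨union_subset (h1.trans hmn) hCn, ?_⟩
    have h3 := card_union_add_card_inter D C
    have h4 : 0 < (D ∩ C).card := card_pos.2 ⟨x, mem_inter.2 ⟨hxD, hxC⟩⟩
    omega
  obtain ⟨hE1, hE2⟩ := hE B hB hxx.1
  obtain ⟨hE1', hE2'⟩ := hE B' hB' hxx.2
  have hEE : (B ∪ C) ∩ (B' ∪ C) = C := by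
    rw [← inter_union_distrib_right, h]
    exact union_eq_right.2 (by simpa using hxC)
  have ext_lem : ∀ E E' : Finset ℕ, E ⊆ grd n → E.card ≤ r → E'.card ≤ r →
      ∃ A, E ⊆ A ∧ A ⊆ grd n ∧ A.card = r ∧ A ∩ E' = E ∩ E' := by
    intro E E' h1 h2 h3
    have hsub : E ⊆ grd n \ (E' \ E) := subset_sdiff.2 ⟨h1, disjoint_sdiff⟩
    have hcard : r ≤ (grd n \ (E' \ E)).card := by
      have h4 := le_card_sdiff (E' \ E) (grd n)
      rw [card_grd] at h4
      have h5 := card_le_card (sdiff_subset : E' \ E ⊆ E')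
      omega
    obtain ⟨A, hA1, hA2, hA3⟩ := exists_subsuperset_card_eq hsub h2 hcard
    refine ⟨A, hA1, hA2.trans sdiff_subset, hA3, ?_⟩
    ext u
    have h6 := @hA1 u
    have h7 := @hA2 u
    simp only [mem_sdiff, mem_inter] at h7 ⊢
    tauto
  obtain ⟨A, hA1, hA2, hA3, hA4⟩ := ext_lem (B ∪ C) (B' ∪ C) hE1 hE2 hE2'
  obtain ⟨A', hA1', hA2', hA3', hA4'⟩ := ext_lem (B' ∪ C) A hE1' hE2' hA3.le
  refine mem_interk.2 ⟨⟨A, ?_, A', ?_, ?_⟩, hCk⟩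
  · exact mem_filter.2 ⟨mem_ksets.2 ⟨hA2, hA3⟩, B, hB, subset_union_left.trans hA1⟩
  · exact mem_filter.2 ⟨mem_ksets.2 ⟨hA2', hA3'⟩, B', hB', subset_union_left.trans hA1'⟩
  · rw [inter_comm, hA4', inter_comm, hA4, hEE]

lemma card_two (n k : ℕ) (U : Finset ℕ) :
    ((ksets n (k + 2)).filter fun C => 2 ≤ (C ∩ U).card).card ≤ U.card ^ 2 * n ^ k := by
  have h : ((ksets n (k + 2)).filter fun C => 2 ≤ (C ∩ U).card) ⊆
      (U.powersetCard 2).biUnion fun D => (ksets n k).image fun E => D ∪ E := by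
    intro C hC
    rw [mem_filter, mem_ksets] at hC
    obtain ⟨⟨hC1, hC2⟩, hC3⟩ := hC
    obtain ⟨D, hD, hD2⟩ := exists_subset_card_eq hC3
    have hDC := hD.trans inter_subset_left
    refine mem_biUnion.2 ⟨D, mem_powersetCard.2 ⟨hD.trans inter_subset_right, hD2⟩, ?_⟩
    refine mem_image.2 ⟨C \ D, mem_ksets.2 ⟨sdiff_subset.trans hC1, ?_⟩, union_sdiff_of_subset hDC⟩
    rw [card_sdiff_of_subset hDC]; omega
  refine (card_le_card h).trans ((card_biUnion_le_card_mul _ _ (n ^ k) ?_).trans ?_)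
  · intro D _
    refine card_image_le.trans ?_
    rw [ksets, card_powersetCard, card_grd]
    exact Nat.choose_le_pow _ _
  · rw [card_powersetCard]
    exact Nat.mul_le_mul_right _ (Nat.choose_le_pow _ _)

/-- Numerical comparison. -/
lemma numer (K a k : ℕ) : ∃ n₀ : ℕ, ∀ n, n₀ ≤ n → K ^ 2 * n ^ k ≤ (n - a).choose (k + 1) := by
  refine ⟨2 * (a + k + 1) + K ^ 2 * (k + 1).factorial * 2 ^ (k + 1), fun n hn => ?_⟩
  have h1 : (n - a + 1 - (k + 1)) ^ (k + 1) ≤ (n - a).descFactorial (k + 1) :=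
    Nat.pow_sub_le_descFactorial _ _
  rw [Nat.descFactorial_eq_factorial_mul_choose] at h1
  have h2 : n ≤ 2 * (n - a + 1 - (k + 1)) := by
    have : 0 ≤ K ^ 2 * (k + 1).factorial * 2 ^ (k + 1) := Nat.zero_le _
    omega
  have h3 := Nat.pow_le_pow_left h2 (k + 1)
  rw [mul_pow] at h3
  have h4 : K ^ 2 * (k + 1).factorial * 2 ^ (k + 1) ≤ n := by omega
  have hpos : 0 < (k + 1).factorial * 2 ^ (k + 1) := by positivity
  refine Nat.le_of_mul_le_mul_left ?_ hpos
  calc (k + 1).factorial * 2 ^ (k + 1) * (K ^ 2 * n ^ k)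
      = (K ^ 2 * (k + 1).factorial * 2 ^ (k + 1)) * n ^ k := by ring
    _ ≤ n * n ^ k := Nat.mul_le_mul_right _ h4
    _ = n ^ (k + 1) := by ring
    _ ≤ 2 ^ (k + 1) * (n - a + 1 - (k + 1)) ^ (k + 1) := h3
    _ ≤ 2 ^ (k + 1) * ((k + 1).factorial * (n - a).choose (k + 1)) := Nat.mul_le_mul_left _ h1
    _ = _ := by ring

lemma card_two' (K a k : ℕ) (hk : 1 ≤ k) : ∃ n₀ : ℕ, ∀ n, n₀ ≤ n → ∀ U : Finset ℕ, U.card ≤ K →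
    ((ksets n k).filter fun C => 2 ≤ (C ∩ U).card).card ≤ (n - a).choose (k - 1) := by
  obtain rfl | ⟨k, rfl⟩ : k = 1 ∨ ∃ j, k = j + 2 := by
    rcases hk.eq_or_lt with h | h
    · exact Or.inl h.symm
    · exact Or.inr ⟨k - 2, by omega⟩
  · refine ⟨0, fun n _ U _ => ?_⟩
    rw [filter_eq_empty_iff.2]
    · simp
    · intro C hC h
      have := (mem_ksets.1 hC).2
      have := card_le_card (inter_subset_left : C ∩ U ⊆ C)
      omega
  · obtain ⟨n₀, h⟩ := numer K a k
    refine ⟨n₀, fun n hn U hU => (card_two n k U).trans (le_trans ?_ (h n hn))⟩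
    exact Nat.mul_le_mul_right _ (Nat.pow_le_pow_left hU 2)

lemma upper (k r : ℕ) (hk : 1 ≤ k) (hkr : k ≤ r) : ∃ n₀ : ℕ, ∀ n, n₀ ≤ n →
    beta n r k ≤ n.choose k - (n - alpha (r - k + 1)).choose k := by
  obtain ⟨s, hs⟩ : ∃ s, s = r - k + 1 := ⟨_, rfl⟩
  rw [← hs]
  have hs1 : 1 ≤ s := by omega
  obtain ⟨K, hK⟩ := kernel r (by omega)
  obtain ⟨n₁, hn₁⟩ := card_two' K (alpha s) k hk
  have hapos := alpha_pos s hs1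
  refine ⟨2 * r + n₁ + alpha s, fun n hn => ?_⟩
  obtain ⟨F, hF, hFI, hFc⟩ := beta_mem n r k
  rw [← hFc]
  obtain ⟨G, hGI, hGK, hGn, hG⟩ := hK n (by omega) F hF hFI
  classical
  let S := G.filter fun B => B.card ≤ s
  have hSG : ∀ B ∈ S, B ∈ G := fun B hB => (mem_filter.1 hB).1
  have hSI : IsIntersecting S := fun A hA B hB => hGI A (hSG A hA) B (hSG B hB)
  have hSc : ∀ A ∈ S, A.card ≤ s := fun B hB => (mem_filter.1 hB).2
  let P := (grd n).filter fun x => Sing S x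
  have hPS : ∀ x ∈ P, Sing S x := fun x hx => (mem_filter.1 hx).2
  have hPn : P ⊆ grd n := filter_subset _ _
  have hPle : P.card ≤ alpha s := le_alpha s hs1 S hSI hSc P hPS
  rcases hPle.eq_or_lt with hP | hP
  ·
    rw [← hP, ← card_meet n k P hPn]
    apply card_le_card
    intro C hC
    refine mem_filter.2 ⟨interk_subset hF hC, ?_⟩
    by_contra hcon
    rw [not_nonempty_iff_eq_empty, ← disjoint_iff_inter_eq_empty] at hcon
    obtain ⟨⟨A, hA, A', hA', hAA⟩, hCk⟩ := mem_interk.1 hC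
    obtain ⟨hT1, hT2, hT3⟩ := opt_trim s hs1 S hSI hSc P hPS hP C hcon
    have hcov : ∀ D ∈ F, C ⊆ D → (D \ C).card + 1 ≤ s ∧
        ∀ T ∈ S.image (· \ C), (T ∩ (D \ C)).Nonempty := by
      intro D hD hCD
      have hc : (D \ C).card + 1 ≤ s := by
        rw [card_sdiff_of_subset hCD, (mem_ksets.1 (hF hD)).2]; omega
      refine ⟨hc, opt_cover s hs1 _ hT1 hT2 P hT3 hP _ hc ?_⟩
      intro T hT hTs
      obtain ⟨B, hB, rfl⟩ := mem_image.1 hT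
      have hBC : B \ C = B := eq_of_subset_of_card_le sdiff_subset (by rw [hTs]; exact hSc B hB)
      obtain ⟨B', hB', hBD⟩ := hG D hD
      obtain ⟨u, hu⟩ := hGI B (hSG B hB) B' hB'
      rw [mem_inter] at hu
      refine ⟨u, ?_⟩
      have hu1 : u ∈ B \ C := by rw [hBC]; exact hu.1
      exact mem_inter.2 ⟨hu1, mem_sdiff.2 ⟨hBD hu.2, (mem_sdiff.1 hu1).2⟩⟩
    obtain ⟨ha1, ha2⟩ := hcov A hA (hAA ▸ inter_subset_left)
    obtain ⟨hb1, hb2⟩ := hcov A' hA' (hAA ▸ inter_subset_right)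
    obtain ⟨y, hyP, hy⟩ := exists_fresh ∅ P
    have key := le_alpha s hs1
      (insert (insert y (A \ C)) (insert (insert y (A' \ C)) (S.image (· \ C)))) (by
      intro X hX Y hY
      rw [mem_insert, mem_insert] at hX hY
      rcases hX with rfl | rfl | hX <;> rcases hY with rfl | rfl | hY
      · exact ⟨y, by simp⟩
      · exact ⟨y, by simp⟩
      · rw [inter_comm]
        exact (ha2 Y hY).mono (inter_subset_inter_left (subset_insert _ _))
      · exact ⟨y, by simp⟩
      · exact ⟨y, by simp⟩
      · rw [inter_comm]
        exact (hb2 Y hY).mono (inter_subset_inter_left (subset_insert _ _))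
      · exact (ha2 X hX).mono (inter_subset_inter_left (subset_insert _ _))
      · exact (hb2 X hX).mono (inter_subset_inter_left (subset_insert _ _))
      · exact hT1 X hX Y hY) (by
      intro X hX
      rw [mem_insert, mem_insert] at hX
      rcases hX with rfl | rfl | hX
      · exact (card_insert_le _ _).trans ha1
      · exact (card_insert_le _ _).trans hb1
      · exact hT2 X hX) (insert y P) (by
      intro x hx
      rw [mem_insert] at hx
      rcases hx with rfl | hx
      · refine ⟨_, mem_insert_self _ _, insert x (A' \ C), by simp, ?_⟩
        ext u
        have hu : u ∈ A ∩ A' ↔ u ∈ C := by rw [hAA]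
        simp only [mem_inter, mem_insert, mem_sdiff, mem_singleton] at hu ⊢
        tauto
      · obtain ⟨X, hX, Y, hY, h⟩ := hT3 x hx
        exact ⟨X, mem_insert_of_mem (mem_insert_of_mem hX), Y,
          mem_insert_of_mem (mem_insert_of_mem hY), h⟩)
    rw [card_insert_of_notMem hyP] at key
    omega
  · have hsub : interk F k ⊆ ((ksets n k).filter fun C => (C ∩ P).Nonempty) ∪
        ((ksets n k).filter fun C => 2 ≤ (C ∩ G.sup id).card) := by
      intro C hC
      have hCn := interk_subset hF hC
      obtain ⟨⟨A, hA, A', hA', hAA⟩, hCk⟩ := mem_interk.1 hC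
      obtain ⟨B, hB, hBA⟩ := hG A hA
      obtain ⟨B', hB', hBA'⟩ := hG A' hA'
      have hU : ∀ B ∈ G, B ⊆ G.sup id := fun B hB => le_sup (f := id) hB
      have big : ∀ D ∈ F, C ⊆ D → ∀ B ∈ G, B ⊆ D → s < B.card → 2 ≤ (C ∩ G.sup id).card := by
        intro D hD hCD B hB hBD hBs
        have h1 := card_union_add_card_inter C B
        have h2 := card_le_card (union_subset hCD hBD)
        have h3 := (mem_ksets.1 (hF hD)).2
        have h4 := card_le_card (inter_subset_inter_left (hU B hB) : C ∩ B ⊆ C ∩ G.sup id)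
        omega
      rw [mem_union, mem_filter, mem_filter]
      by_cases h2 : 2 ≤ (C ∩ G.sup id).card
      · exact Or.inr ⟨hCn, h2⟩
      left
      refine ⟨hCn, ?_⟩
      have hBs : B.card ≤ s := by
        by_contra hcon
        exact h2 (big A hA (hAA ▸ inter_subset_left) B hB hBA (by omega))
      have hBs' : B'.card ≤ s := by
        by_contra hcon
        exact h2 (big A' hA' (hAA ▸ inter_subset_right) B' hB' hBA' (by omega))
      have hsubC : B ∩ B' ⊆ C := hAA ▸ inter_subset_inter hBA hBA'
      have h3 : B ∩ B' ⊆ C ∩ G.sup id :=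
        subset_inter hsubC (inter_subset_left.trans (hU B hB))
      have h4 := card_le_card h3
      have h5 := card_pos.2 (hGI B hB B' hB')
      obtain ⟨x, hx⟩ := card_eq_one.1 (by omega : (B ∩ B').card = 1)
      have hxm : x ∈ B ∩ B' := by rw [hx]; simp
      refine ⟨x, mem_inter.2 ⟨hsubC hxm, mem_filter.2 ⟨hGn B hB (mem_inter.1 hxm).1, ?_⟩⟩⟩
      exact ⟨B, mem_filter.2 ⟨hB, hBs⟩, B', mem_filter.2 ⟨hB', hBs'⟩, hx⟩
    have h1 := (card_le_card hsub).trans (card_union_le _ _)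
    rw [card_meet n k P hPn] at h1
    have h2 := hn₁ n (by omega) (G.sup id) hGK
    have h3 : (n - alpha s + 1).choose k ≤ (n - P.card).choose k :=
      Nat.choose_le_choose k (by omega)
    have h4 : (n - alpha s + 1).choose k =
        (n - alpha s).choose (k - 1) + (n - alpha s).choose k := by
      obtain ⟨j, rfl⟩ : ∃ j, k = j + 1 := ⟨k - 1, by omega⟩
      simp [Nat.choose_succ_succ]
    have h5 : (n - P.card).choose k ≤ n.choose k := Nat.choose_le_choose k (by omega)
    omega

/-- Main theorem (value of `β`): for `n` large,
`β(n,r,k)` equals the number of `k`-subsets of `[n]` meeting `[α^(r-k+1)]`,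
which is `C(n,k) - C(n - α^(r-k+1), k)`. -/
theorem stmt_2 (k r : ℕ) (hk : 1 ≤ k) (hkr : k ≤ r) :
    ∃ n₀ : ℕ, ∀ n, n₀ ≤ n →
      beta n r k =
        ((ksets n k).filter fun C =>
          (C ∩ Finset.Icc 1 (alpha (r - k + 1))).Nonempty).card ∧
      beta n r k = n.choose k - (n - alpha (r - k + 1)).choose k := by
  obtain ⟨n₁, h₁⟩ := lower k r hk hkr
  obtain ⟨n₂, h₂⟩ := upper k r hk hkr
  refine ⟨n₁ + n₂ + alpha (r - k + 1), fun n hn => ?_⟩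
  have h := le_antisymm (h₂ n (by omega)) (h₁ n (by omega))
  refine ⟨?_, h⟩
  rw [h, card_meet n k _ (Icc_subset_Icc_right (by omega))]
  simp
end

section
/- Let r ≥ 2. There exist n ≥ r and an intersecting family 𝒜 ⊆ [n]^(r) with |𝒜⟨1⟩| ≥ C(2r−3, r−1) + 2r − 2, where C(·,·) denotes the binomial coefficient. In particular α^(r) ≥ C(2r−3, r−1) + 2r − 2. -/
open Finset

theorem mem_interPts (𝒜 : Finset (Finset ℕ)) (x : ℕ) :
    x ∈ interPts 𝒜 ↔ ∃ A ∈ 𝒜, ∃ B ∈ 𝒜, A ∩ B = {x} := by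
  unfold interPts interk
  rw [Finset.mem_sup]
  constructor
  · rintro ⟨C, hC, hx⟩
    simp only [mem_filter, mem_image, mem_product, Prod.exists] at hC
    obtain ⟨⟨A, B, ⟨hA, hB⟩, rfl⟩, hc⟩ := hC
    obtain ⟨z, hz⟩ := Finset.card_eq_one.1 hc
    refine ⟨A, hA, B, hB, ?_⟩
    simp only [id] at hx
    rw [hz] at hx ⊢
    rw [Finset.mem_singleton.1 hx]
  · rintro ⟨A, hA, B, hB, h⟩
    refine ⟨{x}, ?_, by simp⟩
    simp only [mem_filter, mem_image, mem_product, Prod.exists]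
    exact ⟨⟨A, B, ⟨hA, hB⟩, h⟩, by simp⟩

theorem card_interk_one (𝒜 : Finset (Finset ℕ)) :
    (interk 𝒜 1).card = (interPts 𝒜).card := by
  have : interk 𝒜 1 = (interPts 𝒜).image (fun x => ({x} : Finset ℕ)) := by
    ext C
    simp only [mem_image, mem_interPts]
    unfold interk
    simp only [mem_filter, mem_image, mem_product, Prod.exists]
    constructor
    · rintro ⟨⟨A, B, ⟨hA, hB⟩, rfl⟩, hc⟩
      obtain ⟨z, hz⟩ := Finset.card_eq_one.1 hc
      exact ⟨z, ⟨A, hA, B, hB, hz⟩, hz.symm⟩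
    · rintro ⟨x, ⟨A, hA, B, hB, h⟩, rfl⟩
      exact ⟨⟨A, B, ⟨hA, hB⟩, h⟩, by simp⟩
  rw [this, Finset.card_image_of_injective _ Finset.singleton_injective]

/-- A crude set-pair bound. -/
theorem setpair_bound (b : ℕ) : ∀ a : ℕ, ∃ N : ℕ, ∀ (S : Finset ℕ) (A B : ℕ → Finset ℕ),
    (∀ x ∈ S, (A x).card ≤ a) → (∀ x ∈ S, (B x).card ≤ b) →
    (∀ x ∈ S, Disjoint (A x) (B x)) →
    (∀ x ∈ S, ∀ y ∈ S, x ≠ y → (A x ∩ B y).Nonempty ∨ x ∈ B y) → S.card ≤ N := by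
  intro a
  induction a with
  | zero =>
    refine ⟨1 + b, fun S A B hA hB hd hx => ?_⟩
    rcases S.eq_empty_or_nonempty with rfl | ⟨y, hy⟩
    · simp
    have : S ⊆ {y} ∪ B y := by
      intro x hxS
      by_cases hxy : x = y
      · simp [hxy]
      · rcases hx x hxS y hy hxy with h | h
        · have := Finset.card_eq_zero.1 (Nat.le_zero.1 (hA x hxS))
          simp [this] at h
        · simp [h]
    refine (card_le_card this).trans ((card_union_le _ _).trans ?_)
    have := hB y hy
    simp; omega
  | succ a ih =>
    obtain ⟨N, hN⟩ := ih
    refine ⟨1 + b + b * N, fun S A B hA hB hd hx => ?_⟩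
    rcases S.eq_empty_or_nonempty with rfl | ⟨y, hy⟩
    · simp
    have hsub : S ⊆ ({y} ∪ B y) ∪ (B y).biUnion (fun p => S.filter (fun x => p ∈ A x)) := by
      intro x hxS
      by_cases hxy : x = y
      · simp [hxy]
      · rcases hx x hxS y hy hxy with ⟨p, hp⟩ | h
        · rw [mem_inter] at hp
          refine mem_union_right _ (mem_biUnion.2 ⟨p, hp.2, ?_⟩)
          simp [hxS, hp.1]
        · simp [h]
    have hbi : ((B y).biUnion (fun p => S.filter (fun x => p ∈ A x))).card ≤ b * N := by
      refine (card_biUnion_le_card_mul _ _ N ?_).trans (Nat.mul_le_mul_right _ (hB y hy))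
      intro p hp
      apply hN _ (fun x => (A x).erase p) B
      · intro x hx'
        rw [mem_filter] at hx'
        have := hA x hx'.1
        rw [card_erase_of_mem hx'.2]
        omega
      · intro x hx'
        exact hB x (mem_filter.1 hx').1
      · intro x hx'
        exact (hd x (mem_filter.1 hx').1).mono_left (erase_subset _ _)
      · intro x hx' z hz hxz
        rw [mem_filter] at hx' hz
        rcases hx x hx'.1 z hz.1 hxz with ⟨q, hq⟩ | h
        · left
          rw [mem_inter] at hq
          refine ⟨q, ?_⟩
          rw [mem_inter, mem_erase]
          refine ⟨⟨?_, hq.1⟩, hq.2⟩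
          rintro rfl
          exact disjoint_left.1 (hd z hz.1) hz.2 hq.2
        · exact Or.inr h
    refine (card_le_card hsub).trans ((card_union_le _ _).trans (Nat.add_le_add ?_ hbi))
    refine (card_union_le _ _).trans ?_
    have := hB y hy
    simp; omega

theorem interPts_bound (r : ℕ) : ∃ N : ℕ, ∀ (n : ℕ) (𝒜 : Finset (Finset ℕ)), 𝒜 ⊆ ksets n r →
    IsIntersecting 𝒜 → (interPts 𝒜).card ≤ N := by
  obtain ⟨N, hN⟩ := setpair_bound r r
  refine ⟨N, fun n 𝒜 hs hI => ?_⟩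
  have hc : ∀ A ∈ 𝒜, A.card = r := fun A hA => (mem_powersetCard.1 (hs hA)).2
  have h := fun x (hx : x ∈ interPts 𝒜) => (mem_interPts 𝒜 x).1 hx
  choose! A hA B hB hAB using h
  apply hN (interPts 𝒜) (fun x => (A x).erase x) B
  · intro x hx
    exact (card_erase_le).trans (hc _ (hA x hx)).le
  · intro x hx
    exact (hc _ (hB x hx)).le
  · intro x hx
    rw [disjoint_left]
    intro q hq hq'
    rw [mem_erase] at hq
    have : q ∈ A x ∩ B x := mem_inter.2 ⟨hq.2, hq'⟩
    rw [hAB x hx, mem_singleton] at this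
    exact hq.1 this
  · intro x hx y hy _
    obtain ⟨q, hq⟩ := hI _ (hA x hx) _ (hB y hy)
    rw [mem_inter] at hq
    by_cases hqx : q = x
    · right; rw [← hqx]; exact hq.2
    · left; exact ⟨q, mem_inter.2 ⟨mem_erase.2 ⟨hqx, hq.1⟩, hq.2⟩⟩

theorem le_alpha_s8 (r n : ℕ) (hn : r ≤ n) (𝒜 : Finset (Finset ℕ)) (hs : 𝒜 ⊆ ksets n r)
    (hI : IsIntersecting 𝒜) : (interPts 𝒜).card ≤ alpha r := by
  obtain ⟨N, hN⟩ := interPts_bound r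
  have h1 : ∀ m, ∀ k ∈ {k | ∃ 𝒜 ⊆ ksets m r, IsIntersecting 𝒜 ∧ (interk 𝒜 1).card = k},
      k ≤ N := by
    rintro m k ⟨ℬ, hb, hb', rfl⟩
    rw [card_interk_one]
    exact hN m ℬ hb hb'
  have h2 : (interPts 𝒜).card ≤ beta n r 1 :=
    le_csSup ⟨N, h1 n⟩ ⟨𝒜, hs, hI, card_interk_one 𝒜⟩
  refine h2.trans (le_csSup ⟨N, ?_⟩ ⟨n, hn, rfl⟩)
  rintro k ⟨m, _, rfl⟩
  exact csSup_le' (h1 m)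

theorem construction (r : ℕ) (hr : 3 ≤ r) :
    ∃ n, r ≤ n ∧ ∃ 𝒜 ⊆ ksets n r, IsIntersecting 𝒜 ∧
      (2 * r - 3).choose (r - 1) + 2 * r - 2 ≤ (interPts 𝒜).card := by
  classical
  set X : Finset ℕ := Finset.Icc 1 (2 * r - 2) with hX
  have hXc : X.card = 2 * r - 2 := by simp [hX]
  have h1X : 1 ∈ X := by rw [hX, mem_Icc]; omega
  let e : Finset ℕ → ℕ := fun P => 2 * r - 1 + Encodable.encode P
  have he : Function.Injective e := by
    intro P Q h
    exact Encodable.encode_injective (Nat.add_left_cancel h)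
  have heX : ∀ P, e P ∉ X := by
    intro P h
    rw [hX, mem_Icc] at h
    have : e P = 2 * r - 1 + Encodable.encode P := rfl
    omega
  let c : Finset ℕ → Finset ℕ := fun Q => if 1 ∈ Q then X \ Q else Q
  let g : Finset ℕ → ℕ := fun Q => e (c Q)
  have hgX : ∀ P, g P ∉ X := fun P => heX _
  have hgcompl : ∀ Q, Q ⊆ X → g (X \ Q) = g Q := by
    intro Q hQ
    show e (c (X \ Q)) = e (c Q)
    congr 1
    by_cases h : 1 ∈ Q
    · simp [c, h]
    · simp [c, h, h1X, hQ]
  have hg : ∀ Q R, Q ⊆ X → R ⊆ X → g Q = g R → Q = R ∨ Q = X \ R := by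
    intro Q R hQ hR h
    have h' : c Q = c R := he h
    by_cases h1 : 1 ∈ Q <;> by_cases h2 : 1 ∈ R <;> simp only [c, h1, h2, if_true, if_false] at h'
    · left
      rw [← Finset.sdiff_sdiff_eq_self hQ, h', Finset.sdiff_sdiff_eq_self hR]
    · right
      rw [← h', Finset.sdiff_sdiff_eq_self hQ]
    · exact Or.inr h'
    · exact Or.inl h'
  set F := X.powersetCard (r - 1) with hF
  have hFm : ∀ Q, Q ∈ F ↔ Q ⊆ X ∧ Q.card = r - 1 := fun Q => mem_powersetCard
  have hFc : ∀ Q ∈ F, X \ Q ∈ F := by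
    intro Q hQ
    rw [hFm] at hQ ⊢
    refine ⟨sdiff_subset, ?_⟩
    rw [card_sdiff_of_subset hQ.1]
    omega
  let A : Finset ℕ → Finset ℕ := fun Q => insert (g Q) Q
  have hinter : ∀ Q ∈ F, ∀ R ∈ F, g Q ≠ g R → A Q ∩ A R = Q ∩ R := by
    intro Q hQ R hR hne
    have hQ' := ((hFm Q).1 hQ).1
    have hR' := ((hFm R).1 hR).1
    ext z
    simp only [A, mem_inter, mem_insert]
    constructor
    · rintro ⟨rfl | h1, h2 | h2⟩
      · exact absurd h2 hne
      · exact absurd (hR' h2) (hgX _)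
      · exact absurd (hQ' h1) (h2 ▸ hgX _)
      · exact ⟨h1, h2⟩
    · rintro ⟨h1, h2⟩
      exact ⟨Or.inr h1, Or.inr h2⟩
  set 𝒜 := F.image A with h𝒜
  refine ⟨2 * r + F.sup g, by omega, 𝒜, ?_, ?_, ?_⟩
  · intro S hS
    obtain ⟨Q, hQ, rfl⟩ := mem_image.1 hS
    have hQ' := (hFm Q).1 hQ
    refine mem_powersetCard.2 ⟨?_, ?_⟩
    · intro z hz
      rw [grd, mem_Icc]
      rcases mem_insert.1 hz with rfl | hz
      · have h1 : g Q ≤ F.sup g := le_sup hQ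
        have h2 : g Q = 2 * r - 1 + Encodable.encode (c Q) := rfl
        omega
      · have := hQ'.1 hz
        rw [hX, mem_Icc] at this
        omega
    · show (insert (g Q) Q).card = r
      rw [card_insert_of_notMem (fun h => hgX _ (hQ'.1 h))]
      omega
  · intro S hS T hT
    obtain ⟨Q, hQ, rfl⟩ := mem_image.1 hS
    obtain ⟨R, hR, rfl⟩ := mem_image.1 hT
    have hQ' := (hFm Q).1 hQ
    have hR' := (hFm R).1 hR
    by_cases hne : g Q = g R
    · exact ⟨g Q, mem_inter.2 ⟨mem_insert_self _ _, hne ▸ mem_insert_self _ _⟩⟩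
    rw [hinter Q hQ R hR hne]
    by_contra hemp
    rw [not_nonempty_iff_eq_empty, ← disjoint_iff_inter_eq_empty] at hemp
    apply hne
    have : Q = X \ R := by
      apply eq_of_subset_of_card_le (subset_sdiff.2 ⟨hQ'.1, hemp⟩)
      have := (hFm _).1 (hFc R hR)
      omega
    rw [this, hgcompl R hR'.1]
  · set P0 := (X.erase 1).powersetCard (r - 1) with hP0
    have hsub : X ∪ P0.image e ⊆ interPts 𝒜 := by
      intro x hx
      rw [mem_interPts]
      rcases mem_union.1 hx with hx | hx
      · obtain ⟨Q, hQs, hQc⟩ := exists_subset_card_eq (s := X.erase x) (n := r - 2)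
          (by rw [card_erase_of_mem hx]; omega)
        obtain ⟨R, hRs, hRc⟩ := exists_subset_card_eq (s := X.erase x \ Q) (n := r - 2)
          (by rw [card_sdiff_of_subset hQs, card_erase_of_mem hx]; omega)
        have hxQ : x ∉ Q := fun h => by simpa using hQs h
        have hxR : x ∉ R := fun h => by simpa using hRs h
        have hdis : Disjoint Q R := (disjoint_sdiff).mono_right hRs
        have hQF : insert x Q ∈ F := by
          rw [hFm, card_insert_of_notMem hxQ]
          exact ⟨insert_subset hx (hQs.trans (erase_subset _ _)), by omega⟩
        have hRF : insert x R ∈ F := by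
          rw [hFm, card_insert_of_notMem hxR]
          exact ⟨insert_subset hx ((hRs.trans sdiff_subset).trans (erase_subset _ _)), by omega⟩
        refine ⟨_, mem_image_of_mem A hQF, _, mem_image_of_mem A hRF, ?_⟩
        rw [hinter _ hQF _ hRF]
        · rw [← insert_inter_distrib, disjoint_iff_inter_eq_empty.1 hdis]
          rfl
        · intro h
          rcases hg _ _ ((hFm _).1 hQF).1 ((hFm _).1 hRF).1 h with h | h
          · have hne : Q.Nonempty := card_pos.1 (by omega)
            obtain ⟨q, hq⟩ := hne
            have hq2 : q ∈ insert x R := h ▸ mem_insert_of_mem hq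
            rcases mem_insert.1 hq2 with rfl | hq2
            · exact hxQ hq
            · exact disjoint_left.1 hdis hq hq2
          · have : x ∈ X \ insert x R := h ▸ mem_insert_self _ _
            simp at this
      · obtain ⟨P, hP, rfl⟩ := mem_image.1 hx
        have hP' := mem_powersetCard.1 hP
        have h1P : 1 ∉ P := fun h => by simpa using hP'.1 h
        have hPX : P ⊆ X := hP'.1.trans (erase_subset _ _)
        have hPF : P ∈ F := (hFm _).2 ⟨hPX, hP'.2⟩
        have hgP : g P = e P := by simp [g, c, h1P]
        refine ⟨_, mem_image_of_mem A hPF, _, mem_image_of_mem A (hFc P hPF), ?_⟩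
        show insert (g P) P ∩ insert (g (X \ P)) (X \ P) = {e P}
        rw [hgcompl P hPX, ← insert_inter_distrib, inter_sdiff_self, hgP]
        rfl
    refine le_trans (le_of_eq ?_) (card_le_card hsub)
    rw [card_union_of_disjoint, card_image_of_injective _ he, card_powersetCard,
      card_erase_of_mem h1X, hXc]
    · have : 2 * r - 2 - 1 = 2 * r - 3 := by omega
      rw [this]
      omega
    · rw [disjoint_left]
      intro z hz hz'
      obtain ⟨P, _, rfl⟩ := mem_image.1 hz'
      exact heX P hz

theorem construction_two :
    ∃ n, 2 ≤ n ∧ ∃ 𝒜 ⊆ ksets n 2, IsIntersecting 𝒜 ∧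
      (2 * 2 - 3).choose (2 - 1) + 2 * 2 - 2 ≤ (interPts 𝒜).card := by
  refine ⟨3, by norm_num, {{1, 2}, {1, 3}, {2, 3}}, ?_, ?_, ?_⟩
  · decide
  · unfold IsIntersecting; decide
  · decide

/-- Lovász's lower bound: for `r ≥ 2` there is an intersecting family of `r`-sets with at least
`C(2r-3, r-1) + 2r - 2` singleton pairwise intersections; in particular
`α^(r) ≥ C(2r-3, r-1) + 2r - 2`. -/
theorem stmt_8 (r : ℕ) (hr : 2 ≤ r) :
    (∃ n, r ≤ n ∧ ∃ 𝒜 ⊆ ksets n r, IsIntersecting 𝒜 ∧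
      (2 * r - 3).choose (r - 1) + 2 * r - 2 ≤ (interPts 𝒜).card) ∧
    (2 * r - 3).choose (r - 1) + 2 * r - 2 ≤ alpha r := by
  have key : ∃ n, r ≤ n ∧ ∃ 𝒜 ⊆ ksets n r, IsIntersecting 𝒜 ∧
      (2 * r - 3).choose (r - 1) + 2 * r - 2 ≤ (interPts 𝒜).card := by
    rcases hr.eq_or_lt with rfl | h
    · exact construction_two
    · exact construction r h
  refine ⟨key, ?_⟩
  obtain ⟨n, hn, 𝒜, hs, hI, hc⟩ := key
  exact hc.trans (le_alpha_s8 r n hn 𝒜 hs hI)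
end

section
/- Let r ≥ 4. For every n ≥ r and every intersecting family 𝒜 ⊆ [n]^(r), the number of singleton pairwise intersections satisfies |𝒜⟨1⟩| ≤ C(2r−1, r−1) + C(2r−4, r−1), where C(·,·) denotes the binomial coefficient. In particular α^(r) ≤ C(2r−1, r−1) + C(2r−4, r−1). -/
open Finset

lemma span_pow_le {R : Type*} [CommRing R] [Algebra ℚ R] (n : ℕ) (gen : Fin n → R) (b : ℕ) :
    (Submodule.span ℚ (Set.range gen)) ^ b ≤
      Submodule.span ℚ (Set.range fun s : Sym (Fin n) b => ((s : Multiset (Fin n)).map gen).prod) := by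
  induction b with
  | zero =>
    rw [pow_zero, Submodule.one_eq_span]
    apply Submodule.span_mono
    rintro x hx
    rw [Set.mem_singleton_iff] at hx
    subst hx
    exact ⟨Sym.nil, by simp⟩
  | succ b ih =>
    rw [pow_succ]
    refine (mul_le_mul_left ih _).trans ?_
    rw [Submodule.span_mul_span]
    apply Submodule.span_mono
    rintro _ ⟨_, ⟨s, rfl⟩, _, ⟨k, rfl⟩, rfl⟩
    refine ⟨k ::ₛ s, ?_⟩
    show (Multiset.map gen ((k ::ₛ s : Sym (Fin n) (b + 1)) : Multiset (Fin n))).prod = _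
    rw [Sym.coe_cons, Multiset.map_cons, Multiset.prod_cons]
    exact mul_comm _ _

lemma skew_bollobas (a b : ℕ) (S : Finset ℕ) (T Q : ℕ → Finset ℕ)
    (hT : ∀ i ∈ S, (T i).card ≤ a) (hQ : ∀ i ∈ S, (Q i).card ≤ b)
    (hd : ∀ i ∈ S, Disjoint (T i) (Q i))
    (hx : ∀ i ∈ S, ∀ j ∈ S, i < j → ¬ Disjoint (T i) (Q j)) :
    S.card ≤ (a + b).choose a := by
  classical
  let f : S → Polynomial ℚ := fun i =>
    (Polynomial.X + Polynomial.C 1) ^ (a - (T i).card) *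
      ∏ q ∈ T i, (Polynomial.X - Polynomial.C (q : ℚ))
  have hmon1 : ∀ i : S, (∏ q ∈ T i, (Polynomial.X - Polynomial.C (q : ℚ))).Monic := fun i =>
    Polynomial.monic_prod_of_monic _ _ fun q _ => Polynomial.monic_X_sub_C _
  have hmon2 : ∀ i : S, ((Polynomial.X + Polynomial.C (1 : ℚ)) ^ (a - (T i).card)).Monic := fun i =>
    (Polynomial.monic_X_add_C _).pow _
  have hmon : ∀ i, (f i).Monic := fun i => (hmon2 i).mul (hmon1 i)
  have hdeg : ∀ i, (f i).natDegree = a := by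
    intro i
    have h1 := hT i i.2
    show (_ * _ : Polynomial ℚ).natDegree = a
    rw [(hmon2 i).natDegree_mul (hmon1 i), Polynomial.natDegree_prod_of_monic _ _
      (fun q _ => Polynomial.monic_X_sub_C _), (Polynomial.monic_X_add_C _).natDegree_pow]
    simp only [Polynomial.natDegree_X_add_C, Polynomial.natDegree_X_sub_C, sum_const, smul_eq_mul]
    omega
  have heval : ∀ (i : S) (p : ℕ), (f i).eval (p : ℚ) = 0 ↔ p ∈ T i := by
    intro i p
    simp only [f, Polynomial.eval_mul, Polynomial.eval_pow, Polynomial.eval_add, Polynomial.eval_X,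
      Polynomial.eval_C, Polynomial.eval_prod, Polynomial.eval_sub, mul_eq_zero, prod_eq_zero_iff]
    constructor
    · rintro (h | ⟨q, hq, h⟩)
      · have : ((p : ℚ) + 1) ≠ 0 := by positivity
        exact absurd h (pow_ne_zero _ this)
      · have : (p : ℚ) = q := by linarith
        have : p = q := by exact_mod_cast this
        rwa [this]
    · intro h
      exact Or.inr ⟨p, h, sub_self _⟩
  let gen : Fin (a + 1) → (S → ℚ) := fun k i => (f i).coeff k
  let L := Submodule.span ℚ (Set.range gen)
  have h1L : (1 : S → ℚ) ∈ L := by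
    apply Submodule.subset_span
    refine ⟨Fin.last a, ?_⟩
    funext i
    have := (hmon i).coeff_natDegree
    rw [hdeg i] at this
    simpa [gen] using this
  let val : ℕ → (S → ℚ) := fun p i => (f i).eval (p : ℚ)
  have hval : ∀ p, val p ∈ L := by
    intro p
    have : val p = ∑ k : Fin (a + 1), ((p : ℚ) ^ (k : ℕ)) • gen k := by
      funext i
      simp only [val, gen, Finset.sum_apply, Pi.smul_apply, smul_eq_mul]
      rw [Polynomial.eval_eq_sum_range' (n := a + 1) (by rw [hdeg i]; omega), Finset.sum_range]
      exact Finset.sum_congr rfl fun k _ => mul_comm _ _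
    rw [this]
    exact Submodule.sum_mem _ fun k _ => Submodule.smul_mem _ _ (Submodule.subset_span ⟨k, rfl⟩)
  have hprod : ∀ s : Finset ℕ, (∏ p ∈ s, val p) ∈ L ^ s.card := by
    intro s
    induction s using Finset.induction_on with
    | empty => rw [prod_empty, card_empty, pow_zero]; exact Submodule.one_le.mp le_rfl
    | insert x s hxs ih =>
      rw [prod_insert hxs, card_insert_of_notMem hxs, pow_succ']
      exact Submodule.mul_mem_mul (hval x) ih
  have hpow : ∀ m n : ℕ, m ≤ n → L ^ m ≤ L ^ n := by
    intro m n hmn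
    exact pow_le_pow_right₀ (by rw [Submodule.one_le]; exact h1L) hmn
  let g : S → (S → ℚ) := fun j => ∏ p ∈ Q j, val p
  have hgi : ∀ j i : S, g j i = 0 ↔ ¬ Disjoint (T i) (Q j) := by
    intro j i
    simp only [g, Finset.prod_apply, prod_eq_zero_iff, val, heval]
    rw [Finset.not_disjoint_iff]
    constructor
    · rintro ⟨p, h1, h2⟩; exact ⟨p, h2, h1⟩
    · rintro ⟨p, h1, h2⟩; exact ⟨p, h2, h1⟩
  have hlin : LinearIndependent ℚ g := by
    have hdet : (Matrix.of g).det ≠ 0 := by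
      rw [Matrix.det_of_isUpperTriangular]
      · rw [Finset.prod_ne_zero_iff]
        intro i _
        rw [Matrix.of_apply, Ne, hgi, not_not]
        exact hd i i.2
      · intro i j hij
        rw [Matrix.of_apply, hgi]
        exact hx j j.2 i i.2 hij
    exact Matrix.linearIndependent_rows_of_det_ne_zero hdet
  let w : Set (S → ℚ) := Set.range fun s : Sym (Fin (a + 1)) b => ((s : Multiset (Fin (a+1))).map gen).prod
  have hsub : Set.range g ≤ (Submodule.span ℚ w : Set (S → ℚ)) := by
    rintro _ ⟨j, rfl⟩
    exact span_pow_le (a + 1) gen b (hpow _ _ (hQ j j.2) (hprod (Q j)))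
  have h2 := linearIndependent_le_span' g hlin w hsub
  have h3 : Fintype.card w ≤ Fintype.card (Sym (Fin (a + 1)) b) := Fintype.card_range_le _
  rw [Sym.card_sym_eq_choose, Fintype.card_fin] at h3
  have h4 : S.card ≤ Fintype.card w := by
    have := h2
    simpa using this
  have h5 : a + 1 + b - 1 = a + b := by omega
  rw [h5] at h3
  rw [Nat.choose_symm_add]
  omega


def Gsum (r : ℕ) : ℕ := ∑ b ∈ range (r - 1), ∑ a ∈ Icc b (r - 1), (a + b).choose b

lemma hockey (r : ℕ) (m : ℕ) : ∑ b ∈ range (m + 1), (r + b).choose b = (r + m + 1).choose m := by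
  induction m with
  | zero => simp
  | succ m ih =>
    rw [sum_range_succ, ih]
    have : r + (m + 1) + 1 = (r + m + 1) + 1 := by ring
    rw [this, Nat.choose_succ_succ, show r + (m+1) = r + m + 1 by ring]

-- r = k + 1
lemma Gsum_step (k : ℕ) : Gsum (k + 2) = Gsum (k + 1) + (2 * k + 2).choose k + (2 * k).choose k := by
  unfold Gsum
  simp only [show k + 2 - 1 = k + 1 by omega, show k + 1 - 1 = k by omega]
  rw [sum_range_succ]
  have h1 : ∀ b ∈ range k, ∑ a ∈ Icc b (k + 1), (a + b).choose b
      = ∑ a ∈ Icc b k, (a + b).choose b + ((k + 1) + b).choose b := by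
    intro b hb
    rw [mem_range] at hb
    rw [Finset.sum_Icc_succ_top (by omega)]
  rw [sum_congr rfl h1, sum_add_distrib]
  have h2 : ∑ a ∈ Icc k (k + 1), (a + k).choose k = (2 * k).choose k + ((k+1) + k).choose k := by
    rw [Finset.sum_Icc_succ_top (by omega), Icc_self, sum_singleton, two_mul]
  rw [h2]
  have h3 := hockey (k + 1) k
  rw [sum_range_succ] at h3
  rw [show k + 1 + k + 1 = 2 * k + 2 by ring] at h3
  omega

lemma Gsum_closed (k : ℕ) :
    Gsum (k + 1) + 1 + ∑ m ∈ range k, (2 * m).choose (m + 1) = (2 * k + 1).choose (k + 1) := by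
  induction k with
  | zero => simp [Gsum]
  | succ k ih =>
    rw [Gsum_step, sum_range_succ]
    have e1 : (2 * (k + 1) + 1).choose (k + 1 + 1) = (2*k+2).choose (k+1) + (2*k+2).choose (k+2) := by
      rw [show 2 * (k + 1) + 1 = (2 * k + 2) + 1 by ring, Nat.choose_succ_succ]
    have e2 : (2*k+2).choose (k+2) = (2*k+2).choose k := by
      rw [← Nat.choose_symm_of_eq_add]; omega
    have e3 : (2*k+2).choose (k+1) = (2*k+1).choose k + (2*k+1).choose (k+1) := by
      rw [show 2 * k + 2 = (2 * k + 1) + 1 by ring, Nat.choose_succ_succ]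
    have e4 : (2*k+1).choose k = (2*k+1).choose (k+1) := by
      rw [← Nat.choose_symm_of_eq_add]; omega
    have e5 : (2*k+1).choose (k+1) = (2*k).choose k + (2*k).choose (k+1) := by
      rw [Nat.choose_succ_succ]
    omega

lemma cat_ineq (k : ℕ) :
    (2 * (k+1)).choose (k+1) ≤ 1 + (2 * (k+1)).choose (k + 2) + ∑ m ∈ range (k+1), (2 * m).choose (m + 1) := by
  induction k with
  | zero => decide
  | succ k ih =>
    rw [sum_range_succ]
    set j := k + 1 with hj
    have e1 : (2 * (j + 1)).choose (j + 1) = (2*j).choose k + 2 * (2*j).choose j + (2*j).choose (j+1) := by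
      rw [show 2 * (j+1) = (2 * j + 1) + 1 by ring, Nat.choose_succ_succ, Nat.choose_succ_succ, hj,
        Nat.choose_succ_succ]
      ring
    have e2 : (2 * (j + 1)).choose (j + 2) = (2*j).choose j + 2 * (2*j).choose (j+1) + (2*j).choose (j+2) := by
      rw [show 2 * (j+1) = (2 * j + 1) + 1 by ring, Nat.choose_succ_succ, Nat.choose_succ_succ,
        Nat.choose_succ_succ]
      ring
    have e3 : (2*j).choose k = (2*j).choose (j+1) := by
      rw [← Nat.choose_symm_of_eq_add]; omega
    have e4 : k + 1 + 2 = j + 2 := rfl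
    have e5 : k + 2 = j + 1 := rfl
    rw [e5] at ih
    omega

lemma final_arith (r : ℕ) (hr : 4 ≤ r) (N h : ℕ) (h1 : N ≤ Gsum r + h)
    (h2 : 2 * h ≤ (2 * (r - 1)).choose (r - 1)) :
    N ≤ (2 * r - 1).choose (r - 1) + (2 * r - 4).choose (r - 1) := by
  obtain ⟨k, rfl⟩ : ∃ k, r = k + 3 := ⟨r - 3, by omega⟩
  have a1 := Gsum_closed (k + 2)
  have a2 := cat_ineq k
  rw [sum_range_succ] at a1
  rw [show 2 * (k + 3) - 1 = 2 * (k + 2) + 1 by omega, show k + 3 - 1 = k + 2 by omega,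
    show 2 * (k + 3) - 4 = 2 * (k + 1) by omega]
  rw [show k + 3 - 1 = k + 2 by omega] at h2
  have e1 : (2 * (k + 2) + 1).choose (k + 2) = (2 * (k + 2) + 1).choose (k + 2 + 1) := by
    rw [← Nat.choose_symm_of_eq_add]; omega
  have e2 : (2 * (k + 2)).choose (k + 2) = (2*(k+1)+1).choose (k+1) + (2*(k+1)+1).choose (k+2) := by
    rw [show 2 * (k + 2) = (2 * (k+1) + 1) + 1 by ring, Nat.choose_succ_succ]
  have e3 : (2*(k+1)+1).choose (k+1) = (2*(k+1)+1).choose (k+2) := by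
    rw [← Nat.choose_symm_of_eq_add]; omega
  have e4 : (2*(k+1)+1).choose (k+2) = (2*(k+1)).choose (k+1) + (2*(k+1)).choose (k+2) := by
    rw [Nat.choose_succ_succ]
  have e5 : k + 1 + 1 = k + 2 := rfl
  have e6 : k + 2 + 1 = k + 3 := rfl
  simp only [e5, e6] at *
  omega

/-- Critical families: every point of a member is its only common point with another member. -/
structure Crit (r : ℕ) (V : Finset (Finset ℕ)) : Prop where
  size : ∀ F ∈ V, F.card ≤ r
  meet : ∀ A ∈ V, ∀ B ∈ V, (A ∩ B).Nonempty
  crit : ∀ F ∈ V, ∀ x ∈ F, ∃ B ∈ V, F ∩ B = {x}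

lemma stage (r L : ℕ) (hL : 1 ≤ L) (hLr : L ≤ r) (V : Finset (Finset ℕ)) (hV : Crit r V)
    (P0 : Finset ℕ) (hP0 : ∀ F ∈ V, (F \ P0).card ≤ L) :
    ∃ P, (∀ F ∈ V, (F \ P).card ≤ L - 1) ∧
      P.card ≤ P0.card + ∑ t ∈ Icc 1 L, ((r - t) + (r - L)).choose (r - t) := by
  classical
  have key : ∀ P : Finset ℕ, ∃ A B : Finset ℕ, (∃ B ∈ V, L ≤ (B \ P).card) →
      A ∈ V ∧ B ∈ V ∧ L ≤ (B \ P).card ∧ ∃ x, x ∉ P ∧ A ∩ B = {x} := by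
    intro P
    by_cases h : ∃ B ∈ V, L ≤ (B \ P).card
    · obtain ⟨B, hB, hBL⟩ := h
      have : (B \ P).Nonempty := by
        rw [← Finset.card_pos]; omega
      obtain ⟨x, hx⟩ := this
      rw [mem_sdiff] at hx
      obtain ⟨A, hA, hAB⟩ := hV.crit B hB x hx.1
      exact ⟨A, B, fun _ => ⟨hA, hB, hBL, x, hx.2, by rw [inter_comm]; exact hAB⟩⟩
    · exact ⟨∅, ∅, fun h' => absurd h' h⟩
  choose stA stB hst using key
  let Pn : ℕ → Finset ℕ := fun n => Nat.rec P0 (fun _ P => P ∪ stA P) n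
  have hPs : ∀ n, Pn (n + 1) = Pn n ∪ stA (Pn n) := fun n => rfl
  have hmono : Monotone Pn := monotone_nat_of_le_succ fun n => by
    rw [hPs]; exact subset_union_left
  let A : ℕ → Finset ℕ := fun n => stA (Pn n)
  let B : ℕ → Finset ℕ := fun n => stB (Pn n)
  let Bad : ℕ → Prop := fun n => ∃ B ∈ V, L ≤ (B \ Pn n).card
  have hle : ∀ n, ∀ F ∈ V, (F \ Pn n).card ≤ L := fun n F hF =>
    (card_le_card (sdiff_subset_sdiff le_rfl (hmono (Nat.zero_le n)))).trans (hP0 F hF)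
  have hsplit : ∀ (F P : Finset ℕ), (F ∩ P).card + (F \ P).card = F.card := fun F P =>
    card_inter_add_card_sdiff F P
  -- the bound on the number of steps whose increment is at least `t`
  have hbound : ∀ m, (∀ n < m, Bad n) → ∀ t,
      ((range m).filter fun n => t ≤ (A n \ Pn n).card).card ≤ ((r - t) + (r - L)).choose (r - t) := by
    intro m hm t
    apply skew_bollobas _ _ _ (fun n => A n ∩ Pn n) (fun n => B n ∩ Pn n)
    · intro n hn
      rw [mem_filter, mem_range] at hn
      obtain ⟨hA, hB, hBL, x, hx, hAB⟩ := hst (Pn n) (hm n hn.1)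
      have h1 := hsplit (A n) (Pn n)
      have h2 := hV.size _ hA
      have h3 : (A n).card ≤ r := h2
      show (A n ∩ Pn n).card ≤ r - t
      have := hn.2
      omega
    · intro n hn
      rw [mem_filter, mem_range] at hn
      obtain ⟨hA, hB, hBL, x, hx, hAB⟩ := hst (Pn n) (hm n hn.1)
      have h1 := hsplit (B n) (Pn n)
      have h3 : (B n).card ≤ r := hV.size _ hB
      have h4 : L ≤ (B n \ Pn n).card := hBL
      show (B n ∩ Pn n).card ≤ r - L
      omega
    · intro n hn
      rw [mem_filter, mem_range] at hn
      obtain ⟨hA, hB, hBL, x, hx, hAB⟩ := hst (Pn n) (hm n hn.1)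
      rw [Finset.disjoint_left]
      intro y hy hy'
      rw [mem_inter] at hy hy'
      have : y ∈ A n ∩ B n := mem_inter.2 ⟨hy.1, hy'.1⟩
      have h5 : A n ∩ B n = {x} := hAB
      rw [h5, mem_singleton] at this
      exact hx (this ▸ hy.2)
    · intro i hi j hj hij
      rw [mem_filter, mem_range] at hi hj
      obtain ⟨hA, -, -, -⟩ := hst (Pn i) (hm i hi.1)
      obtain ⟨-, hB, hBL, -⟩ := hst (Pn j) (hm j hj.1)
      obtain ⟨y, hy⟩ := hV.meet _ hA _ hB
      rw [mem_inter] at hy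
      have hAP : A i ⊆ Pn j := by
        refine Finset.Subset.trans ?_ (hmono (Nat.succ_le_of_lt hij))
        rw [Nat.succ_eq_add_one, hPs]
        exact subset_union_right
      have hyj : y ∈ Pn j := hAP hy.1
      have heq : B j \ Pn j = B j \ Pn i := by
        apply eq_of_subset_of_card_le (sdiff_subset_sdiff le_rfl (hmono hij.le))
        exact (hle i _ hB).trans hBL
      have hyi : y ∈ Pn i := by
        by_contra hc
        have : y ∈ B j \ Pn i := mem_sdiff.2 ⟨hy.2, hc⟩
        rw [← heq, mem_sdiff] at this
        exact this.2 hyj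
      rw [Finset.not_disjoint_iff]
      exact ⟨y, mem_inter.2 ⟨hy.1, hyi⟩, mem_inter.2 ⟨hy.2, hyj⟩⟩
  have hpos : ∀ n, Bad n → 1 ≤ (A n \ Pn n).card := by
    intro n hn
    obtain ⟨hA, hB, hBL, x, hx, hAB⟩ := hst (Pn n) hn
    have hxA : x ∈ A n ∩ B n := by
      show x ∈ stA (Pn n) ∩ stB (Pn n)
      rw [hAB]; exact mem_singleton_self x
    exact Finset.card_pos.2 ⟨x, mem_sdiff.2 ⟨(mem_inter.1 hxA).1, hx⟩⟩
  have hex : ∃ n, ¬ Bad n := by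
    by_contra hc
    push Not at hc
    have h1 := hbound (((r - 1) + (r - L)).choose (r - 1) + 1) (fun n _ => hc n) 1
    rw [Finset.filter_true_of_mem (fun n _ => hpos n (hc n)), card_range] at h1
    omega
  obtain ⟨m, hm, hmin⟩ : ∃ m, ¬ Bad m ∧ ∀ n < m, Bad n := by
    refine ⟨Nat.find hex, Nat.find_spec hex, fun n hn => ?_⟩
    have := Nat.find_min hex hn
    exact not_not.1 this
  have hcard : ∀ n, (Pn n).card ≤ P0.card + ∑ k ∈ range n, (A k \ Pn k).card := by
    intro n
    induction n with
    | zero => simp [Pn]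
    | succ n ih =>
      rw [hPs, sum_range_succ, ← union_sdiff_self_eq_union]
      have := card_union_le (Pn n) (stA (Pn n) \ Pn n)
      have e : A n = stA (Pn n) := rfl
      rw [e]
      omega
  have hsum : ∑ k ∈ range m, (A k \ Pn k).card
      = ∑ t ∈ Icc 1 L, ((range m).filter fun n => t ≤ (A n \ Pn n).card).card := by
    simp only [card_filter]
    rw [sum_comm]
    apply sum_congr rfl
    intro k hk
    rw [← card_filter]
    obtain ⟨hA, -⟩ := hst (Pn k) (hmin k (mem_range.1 hk))
    have h1 : (A k \ Pn k).card ≤ L := hle k _ hA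
    have : (Icc 1 L).filter (fun t => t ≤ (A k \ Pn k).card) = Icc 1 (A k \ Pn k).card := by
      ext t
      simp only [mem_filter, mem_Icc]
      omega
    rw [this, Nat.card_Icc]
    omega
  refine ⟨Pn m, ?_, ?_⟩
  · intro F hF
    by_contra hc
    exact hm ⟨F, hF, by omega⟩
  · refine (hcard m).trans ?_
    rw [hsum]
    exact Nat.add_le_add_left (sum_le_sum fun t _ => hbound m hmin t) _

lemma stages (r : ℕ) (hr : 1 ≤ r) (V : Finset (Finset ℕ)) (hV : Crit r V) (j : ℕ) (hj : j < r) :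
    ∃ P : Finset ℕ, (∀ F ∈ V, (F \ P).card ≤ r - j) ∧
      P.card ≤ ∑ b ∈ range j, ∑ a ∈ Icc b (r - 1), (a + b).choose b := by
  induction j with
  | zero =>
    exact ⟨∅, fun F hF => by simpa using hV.size F hF, by simp⟩
  | succ j ih =>
    obtain ⟨P0, h1, h2⟩ := ih (by omega)
    obtain ⟨P, h3, h4⟩ := stage r (r - j) (by omega) (by omega) V hV P0 h1
    refine ⟨P, h3, h4.trans ?_⟩
    rw [sum_range_succ]
    refine Nat.add_le_add h2 (le_of_eq ?_)
    refine sum_bij' (fun t _ => r - t) (fun a _ => r - a) ?_ ?_ ?_ ?_ ?_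
    · intro t ht; rw [mem_Icc] at *; omega
    · intro t ht; rw [mem_Icc] at *; omega
    · intro t ht; rw [mem_Icc] at *; omega
    · intro t ht; rw [mem_Icc] at *; omega
    · intro t ht
      rw [show r - (r - j) = j by omega, Nat.choose_symm_add]

lemma last_stage (r : ℕ) (hr : 1 ≤ r) (V : Finset (Finset ℕ)) (hV : Crit r V)
    (h1 : ∀ F ∈ V, 2 ≤ F.card)
    (P : Finset ℕ) (hP : ∀ F ∈ V, (F \ P).card ≤ 1) :
    2 * ((V.sup id) \ P).card ≤ (2 * (r - 1)).choose (r - 1) := by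
  classical
  have key : ∀ x, ∃ F B : Finset ℕ, x ∈ V.sup id \ P → F ∈ V ∧ B ∈ V ∧ F ∩ B = {x} := by
    intro x
    by_cases h : x ∈ V.sup id \ P
    · rw [mem_sdiff, mem_sup] at h
      obtain ⟨⟨F, hF, hxF⟩, -⟩ := h
      obtain ⟨B, hB, hFB⟩ := hV.crit F hF x hxF
      exact ⟨F, B, fun _ => ⟨hF, hB, hFB⟩⟩
    · exact ⟨∅, ∅, fun h' => absurd h' h⟩
  choose F B hFB using key
  set O := V.sup id \ P with hO
  let W : ℕ → Finset ℕ := fun i => if i % 2 = 0 then F (i / 2) else B (i / 2)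
  let W' : ℕ → Finset ℕ := fun i => if i % 2 = 0 then B (i / 2) else F (i / 2)
  let S : Finset ℕ := (O ×ˢ range 2).image fun p => 2 * p.1 + p.2
  have hS : ∀ i ∈ S, i / 2 ∈ O := by
    intro i hi
    simp only [S, mem_image, mem_product, mem_range] at hi
    obtain ⟨⟨x, e⟩, ⟨hx, he⟩, rfl⟩ := hi
    simp only at *
    rwa [show (2 * x + e) / 2 = x by omega]
  have hScard : S.card = 2 * O.card := by
    rw [card_image_of_injOn, card_product, card_range, mul_comm]
    rintro ⟨x, e⟩ hx ⟨y, f⟩ hy h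
    simp only [coe_product, Set.mem_prod, mem_coe, mem_range] at hx hy
    simp only at h
    rw [Prod.mk.injEq]
    omega
  have hW : ∀ i ∈ S, W i ∈ V ∧ W' i ∈ V ∧ W i ∩ W' i = {i / 2} ∧ i / 2 ∉ P := by
    intro i hi
    have h := hS i hi
    obtain ⟨a, b, c⟩ := hFB _ h
    have hn : i / 2 ∉ P := by rw [hO, mem_sdiff] at h; exact h.2
    by_cases e : i % 2 = 0
    · simp only [W, W', if_pos e]; exact ⟨a, b, c, hn⟩
    · simp only [W, W', if_neg e]; exact ⟨b, a, by rw [inter_comm]; exact c, hn⟩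
  have hmem : ∀ i ∈ S, i / 2 ∈ W i ∧ i / 2 ∈ W' i := by
    intro i hi
    obtain ⟨_, _, c, _⟩ := hW i hi
    have : i / 2 ∈ W i ∩ W' i := by rw [c]; exact mem_singleton_self _
    exact mem_inter.1 this
  have hsmall : ∀ G ∈ V, ∀ x ∈ G, x ∉ P → (G ∩ P).card ≤ r - 1 ∧ G \ P = {x} := by
    intro G hG x hx hxP
    have a1 := card_inter_add_card_sdiff G P
    have a2 := hV.size G hG
    have a3 : x ∈ G \ P := mem_sdiff.2 ⟨hx, hxP⟩
    have a4 : 0 < (G \ P).card := card_pos.2 ⟨x, a3⟩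
    have a5 := hP G hG
    refine ⟨by omega, ?_⟩
    symm
    apply eq_of_subset_of_card_le (singleton_subset_iff.2 a3)
    simpa using a5
  rw [← hScard]
  have := skew_bollobas (r - 1) (r - 1) S (fun i => W i ∩ P) (fun i => W' i ∩ P) ?_ ?_ ?_ ?_
  · rwa [← two_mul] at this
  · intro i hi
    obtain ⟨a, b, c, d⟩ := hW i hi
    exact (hsmall _ a _ (hmem i hi).1 d).1
  · intro i hi
    obtain ⟨a, b, c, d⟩ := hW i hi
    exact (hsmall _ b _ (hmem i hi).2 d).1
  · intro i hi
    obtain ⟨a, b, c, d⟩ := hW i hi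
    rw [Finset.disjoint_left]
    intro y hy hy'
    rw [mem_inter] at hy hy'
    have : y ∈ W i ∩ W' i := mem_inter.2 ⟨hy.1, hy'.1⟩
    rw [c, mem_singleton] at this
    exact d (this ▸ hy.2)
  · intro i hi j hj hij
    obtain ⟨a, b, c, d⟩ := hW i hi
    obtain ⟨a', b', c', d'⟩ := hW j hj
    rw [Finset.not_disjoint_iff]
    by_cases hne : i / 2 = j / 2
    · have hi2 : i % 2 = 0 := by omega
      have hj2 : ¬ j % 2 = 0 := by omega
      have : W' j = W i := by
        simp only [W, W', if_pos hi2, if_neg hj2, hne]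
      have h2 := h1 _ a
      have h3 := card_inter_add_card_sdiff (W i) P
      have h4 := hP _ a
      have : (W i ∩ P).Nonempty := by rw [← card_pos]; omega
      obtain ⟨y, hy⟩ := this
      refine ⟨y, hy, ?_⟩
      simp only [‹W' j = W i›]
      exact hy
    · obtain ⟨y, hy⟩ := hV.meet _ a _ b'
      rw [mem_inter] at hy
      have hyP : y ∈ P := by
        by_contra hc
        have e1 := (hsmall _ a _ (hmem i hi).1 d).2
        have e2 := (hsmall _ b' _ (hmem j hj).2 d').2
        have f1 : y ∈ W i \ P := mem_sdiff.2 ⟨hy.1, hc⟩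
        have f2 : y ∈ W' j \ P := mem_sdiff.2 ⟨hy.2, hc⟩
        rw [e1, mem_singleton] at f1
        rw [e2, mem_singleton] at f2
        exact hne (f1.symm.trans f2)
      exact ⟨y, mem_inter.2 ⟨hy.1, hyP⟩, mem_inter.2 ⟨hy.2, hyP⟩⟩

lemma crit_bound (r : ℕ) (hr : 4 ≤ r) (V : Finset (Finset ℕ)) (hV : Crit r V) :
    (V.sup id).card ≤ (2 * r - 1).choose (r - 1) + (2 * r - 4).choose (r - 1) := by
  classical
  by_cases h : ∀ F ∈ V, 2 ≤ F.card
  · obtain ⟨P, h1, h2⟩ := stages r (by omega) V hV (r - 1) (by omega)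
    have h3 := last_stage r (by omega) V hV h P (fun F hF => (h1 F hF).trans (by omega))
    refine final_arith r hr _ (V.sup id \ P).card ?_ h3
    have a1 := card_inter_add_card_sdiff (V.sup id) P
    have a2 : (V.sup id ∩ P).card ≤ P.card := card_le_card inter_subset_right
    unfold Gsum
    omega
  · push Not at h
    obtain ⟨F, hF, hF2⟩ := h
    have h0 : 0 < F.card := by
      have := hV.meet F hF F hF
      rw [inter_self] at this
      exact card_pos.2 this
    obtain ⟨x, rfl⟩ := card_eq_one.1 (show F.card = 1 by omega)
    have hall : ∀ G ∈ V, x ∈ G := by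
      intro G hG
      obtain ⟨y, hy⟩ := hV.meet _ hF G hG
      rw [mem_inter, mem_singleton] at hy
      exact hy.1 ▸ hy.2
    have hsub : V.sup id ⊆ {x} := by
      intro y hy
      rw [mem_sup] at hy
      obtain ⟨G, hG, hyG⟩ := hy
      obtain ⟨B, hB, hGB⟩ := hV.crit G hG y hyG
      have : x ∈ G ∩ B := mem_inter.2 ⟨hall G hG, hall B hB⟩
      rw [hGB, mem_singleton] at this
      rw [mem_singleton, this]
    have a1 := card_le_card hsub
    rw [card_singleton] at a1
    have a2 : 0 < (2 * r - 1).choose (r - 1) := Nat.choose_pos (by omega)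
    omega

lemma shrink (𝒜 : Finset (Finset ℕ)) (s : ℕ) : ∀ F : Finset ℕ → Finset ℕ,
    (∀ A ∈ 𝒜, F A ⊆ A) → (∀ A ∈ 𝒜, ∀ B ∈ 𝒜, (F A ∩ F B).Nonempty) →
    ∑ A ∈ 𝒜, (F A).card = s →
    ∃ F : Finset ℕ → Finset ℕ, (∀ A ∈ 𝒜, F A ⊆ A) ∧
      (∀ A ∈ 𝒜, ∀ B ∈ 𝒜, (F A ∩ F B).Nonempty) ∧
      (∀ A ∈ 𝒜, ∀ x ∈ F A, ∃ B ∈ 𝒜, F A ∩ F B = {x}) := by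
  classical
  induction s using Nat.strong_induction_on with
  | _ s ih =>
    intro F h1 h2 h3
    by_cases h : ∀ A ∈ 𝒜, ∀ x ∈ F A, ∃ B ∈ 𝒜, F A ∩ F B = {x}
    · exact ⟨F, h1, h2, h⟩
    · push Not at h
      obtain ⟨A, hA, x, hx, hn⟩ := h
      have hlt : ((F A).erase x).card < (F A).card := card_erase_lt_of_mem hx
      have hne : ∀ B ∈ 𝒜, ((F A).erase x ∩ F B).Nonempty := by
        intro B hB
        by_contra hc
        rw [not_nonempty_iff_eq_empty] at hc
        apply hn B hB
        apply Finset.Subset.antisymm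
        · intro y hy
          rw [mem_inter] at hy
          rw [mem_singleton]
          by_contra hyx
          have : y ∈ (F A).erase x ∩ F B := mem_inter.2 ⟨mem_erase.2 ⟨hyx, hy.1⟩, hy.2⟩
          rw [hc] at this
          exact absurd this (notMem_empty y)
        · obtain ⟨y, hy⟩ := h2 A hA B hB
          have hyx : y = x := by
            by_contra hyx
            rw [mem_inter] at hy
            have : y ∈ (F A).erase x ∩ F B := mem_inter.2 ⟨mem_erase.2 ⟨hyx, hy.1⟩, hy.2⟩
            rw [hc] at this
            exact absurd this (notMem_empty y)
          rw [singleton_subset_iff]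
          exact hyx ▸ hy
      let F' := Function.update F A ((F A).erase x)
      have hFA : F' A = (F A).erase x := Function.update_self _ _ _
      have hFB : ∀ B, B ≠ A → F' B = F B := fun B hB => Function.update_of_ne hB _ _
      refine ih _ ?_ F' ?_ ?_ rfl
      · rw [← h3]
        apply sum_lt_sum
        · intro B hB
          by_cases e : B = A
          · subst e; rw [hFA]; exact hlt.le
          · rw [hFB B e]
        · exact ⟨A, hA, by rw [hFA]; exact hlt⟩
      · intro B hB
        by_cases e : B = A
        · subst e; rw [hFA]; exact (erase_subset _ _).trans (h1 _ hB)
        · rw [hFB B e]; exact h1 B hB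
      · intro B hB C hC
        by_cases e : B = A
        · subst e
          rw [hFA]
          by_cases e' : C = B
          · subst e'
            rw [hFA]
            obtain ⟨y, hy⟩ := hne C hC
            exact ⟨y, by rw [inter_self]; exact (mem_inter.1 hy).1⟩
          · rw [hFB C e']; exact hne C hC
        · rw [hFB B e]
          by_cases e' : C = A
          · subst e'; rw [hFA, inter_comm]; exact hne B hB
          · rw [hFB C e']; exact h2 B hB C hC

lemma point_bound (r : ℕ) (hr : 4 ≤ r) (𝒜 : Finset (Finset ℕ)) (hc : ∀ A ∈ 𝒜, A.card = r)
    (hI : ∀ A ∈ 𝒜, ∀ B ∈ 𝒜, (A ∩ B).Nonempty) (X : Finset ℕ)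
    (hX : ∀ x ∈ X, ∃ A ∈ 𝒜, ∃ B ∈ 𝒜, A ∩ B = {x}) :
    X.card ≤ (2 * r - 1).choose (r - 1) + (2 * r - 4).choose (r - 1) := by
  classical
  obtain ⟨F, h1, h2, h3⟩ := shrink 𝒜 _ id (fun A _ => le_rfl) hI rfl
  have hV : Crit r (𝒜.image F) := by
    refine ⟨?_, ?_, ?_⟩
    · intro G hG
      obtain ⟨A, hA, rfl⟩ := mem_image.1 hG
      exact (card_le_card (h1 A hA)).trans (hc A hA).le
    · intro G hG H hH
      obtain ⟨A, hA, rfl⟩ := mem_image.1 hG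
      obtain ⟨B, hB, rfl⟩ := mem_image.1 hH
      exact h2 A hA B hB
    · intro G hG x hx
      obtain ⟨A, hA, rfl⟩ := mem_image.1 hG
      obtain ⟨B, hB, h⟩ := h3 A hA x hx
      exact ⟨F B, mem_image_of_mem F hB, h⟩
  refine le_trans (card_le_card ?_) (crit_bound r hr _ hV)
  intro x hx
  obtain ⟨A, hA, B, hB, hAB⟩ := hX x hx
  obtain ⟨y, hy⟩ := h2 A hA B hB
  rw [mem_inter] at hy
  have : y ∈ A ∩ B := mem_inter.2 ⟨h1 A hA hy.1, h1 B hB hy.2⟩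
  rw [hAB, mem_singleton] at this
  subst this
  rw [mem_sup]
  exact ⟨F A, mem_image_of_mem F hA, hy.1⟩

lemma interPts_bound_s9 (r n : ℕ) (hr : 4 ≤ r) (𝒜 : Finset (Finset ℕ)) (hA : 𝒜 ⊆ ksets n r)
    (hI : IsIntersecting 𝒜) :
    (interPts 𝒜).card ≤ (2 * r - 1).choose (r - 1) + (2 * r - 4).choose (r - 1) := by
  refine point_bound r hr 𝒜 (fun A h => (mem_powersetCard.1 (hA h)).2) hI _ ?_
  intro x hx
  unfold interPts at hx
  rw [mem_sup] at hx
  obtain ⟨C, hC, hxC⟩ := hx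
  unfold interk at hC
  rw [mem_filter, mem_image] at hC
  obtain ⟨⟨⟨A, B⟩, hAB, rfl⟩, h1⟩ := hC
  rw [mem_product] at hAB
  obtain ⟨y, hy⟩ := card_eq_one.1 h1
  refine ⟨A, hAB.1, B, hAB.2, ?_⟩
  simp only [id] at hy hxC
  rw [hy, mem_singleton] at hxC
  rw [hy, hxC]

lemma interk_card_le (𝒜 : Finset (Finset ℕ)) : (interk 𝒜 1).card ≤ (interPts 𝒜).card := by
  have : interk 𝒜 1 ⊆ (interPts 𝒜).image fun x => {x} := by
    intro C hC
    have h1 : C.card = 1 := by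
      have := hC
      unfold interk at this
      exact (mem_filter.1 this).2
    obtain ⟨y, rfl⟩ := card_eq_one.1 h1
    refine mem_image.2 ⟨y, ?_, rfl⟩
    unfold interPts
    rw [mem_sup]
    exact ⟨{y}, hC, mem_singleton_self y⟩
  exact (card_le_card this).trans card_image_le

/-- Tuza's upper bound: for `r ≥ 4`, every intersecting family of `r`-sets has at most
`C(2r-1, r-1) + C(2r-4, r-1)` singleton pairwise intersections; in particular
`α^(r) ≤ C(2r-1, r-1) + C(2r-4, r-1)`. -/
theorem stmt_9 (r : ℕ) (hr : 4 ≤ r) :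
    (∀ n, r ≤ n → ∀ 𝒜 ⊆ ksets n r, IsIntersecting 𝒜 →
      (interPts 𝒜).card ≤ (2 * r - 1).choose (r - 1) + (2 * r - 4).choose (r - 1)) ∧
    alpha r ≤ (2 * r - 1).choose (r - 1) + (2 * r - 4).choose (r - 1) := by 
  refine ⟨fun n _ 𝒜 hA hI => interPts_bound_s9 r n hr 𝒜 hA hI, ?_⟩
  unfold alpha
  apply csSup_le'
  rintro _ ⟨n, _, rfl⟩
  unfold beta
  apply csSup_le'
  rintro _ ⟨𝒜, hA, hI, rfl⟩
  exact (interk_card_le 𝒜).trans (interPts_bound_s9 r n hr 𝒜 hA hI)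
end
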